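/- arXiv:2206.11416 — 15 statements merged into one kernel-verified Lean document; each statement's English description precedes it below -/
import Mathlib

section
/- Let L : (0,∞) → ℝ be differentiable with L' positive and monotone non-increasing on (0,∞). If τ, ξ, y > 0 satisfy Sw(τ,ξ,y) = 0, then τ ≥ 2. If moreover L' is strictly decreasing on (0,∞), then τ > 2. -/
/-- The switching function `Sw(τ,ξ,y) = ∫_y^{y+ξτ} ζ·L'(ζ) dζ − (ξ+y)·(L(y+ξτ) − L(y))`. -/
noncomputable def Sw (L : ℝ → ℝ) (τ ξ y : ℝ) : ℝ :=
  (∫ ζ in y..(y + ξ * τ), ζ * deriv L ζ) - (ξ + y) * (L (y + ξ * τ) - L y)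

/-- If `L` is differentiable on `(0,∞)` with `L'` positive and monotone
non-increasing there, and `τ, ξ, y > 0` satisfy `Sw(τ,ξ,y) = 0`, then `τ ≥ 2`;
if moreover `L'` is strictly decreasing on `(0,∞)` then `τ > 2`. -/
theorem stmt_1 (L : ℝ → ℝ)
    (hdiff : ∀ y : ℝ, 0 < y → DifferentiableAt ℝ L y)
    (hpos : ∀ y : ℝ, 0 < y → 0 < deriv L y)
    (hanti : AntitoneOn (deriv L) (Set.Ioi 0))
    (τ ξ y : ℝ) (hτ : 0 < τ) (hξ : 0 < ξ) (hy : 0 < y)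
    (hSw : Sw L τ ξ y = 0) :
    2 ≤ τ ∧ (StrictAntiOn (deriv L) (Set.Ioi 0) → 2 < τ) := by
  have hT : 0 < ξ * τ := mul_pos hξ hτ
  have hint : ∀ a b : ℝ, 0 < a → 0 < b → IntervalIntegrable (deriv L) MeasureTheory.volume a b := by
    intro a b ha hb
    apply AntitoneOn.intervalIntegrable
    apply hanti.mono
    intro x hx
    exact lt_of_lt_of_le (lt_min ha hb) hx.1
  have hb : 0 < y + ξ * τ := by linarith
  have hFTC : ∫ ζ in y..(y + ξ * τ), deriv L ζ = L (y + ξ * τ) - L y := by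
    apply intervalIntegral.integral_deriv_eq_sub
    · intro x hx
      exact hdiff x (lt_of_lt_of_le (lt_min hy hb) hx.1)
    · exact hint _ _ hy hb
  have hc : 0 < ξ + y := by linarith
  have hI1 : ∀ a b : ℝ, 0 < a → 0 < b →
      IntervalIntegrable (fun ζ => ζ * deriv L ζ) MeasureTheory.volume a b := by
    intro a b ha hb
    exact (hint a b ha hb).continuousOn_mul continuousOn_id
  have hI2 : ∀ a b : ℝ, IntervalIntegrable (fun ζ => deriv L (ξ + y) * (ζ - (ξ + y)))
      MeasureTheory.volume a b := by
    intro a b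
    exact Continuous.intervalIntegrable (by fun_prop) a b
  have heq : (fun ζ => (ζ - (ξ + y)) * (deriv L (ξ + y) - deriv L ζ)) =
      fun ζ => deriv L (ξ + y) * (ζ - (ξ + y)) - (ζ * deriv L ζ - (ξ + y) * deriv L ζ) := by
    funext ζ; ring
  have hI : ∀ a b : ℝ, 0 < a → 0 < b →
      IntervalIntegrable (fun ζ => (ζ - (ξ + y)) * (deriv L (ξ + y) - deriv L ζ))
        MeasureTheory.volume a b := by
    intro a b ha hb
    rw [heq]
    exact (hI2 a b).sub ((hI1 a b ha hb).sub ((hint a b ha hb).const_mul _))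
  have hval : ∫ ζ in y..(y + ξ * τ), (ζ - (ξ + y)) * (deriv L (ξ + y) - deriv L ζ) =
      deriv L (ξ + y) * (ξ ^ 2 * τ * (τ - 2) / 2) := by
    rw [heq, intervalIntegral.integral_sub (hI2 _ _)
      ((hI1 _ _ hy hb).sub ((hint _ _ hy hb).const_mul _)),
      intervalIntegral.integral_sub (hI1 _ _ hy hb) ((hint _ _ hy hb).const_mul _),
      intervalIntegral.integral_const_mul, intervalIntegral.integral_const_mul, hFTC]
    unfold Sw at hSw
    rw [hSw, intervalIntegral.integral_sub (by simp) (by simp)]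
    simp only [integral_id, intervalIntegral.integral_const, smul_eq_mul]
    ring
  have hnn : ∀ x : ℝ, 0 < x → 0 ≤ (x - (ξ + y)) * (deriv L (ξ + y) - deriv L x) := by
    intro x hx
    rcases le_total x (ξ + y) with h | h
    · have := hanti (Set.mem_Ioi.2 hx) (Set.mem_Ioi.2 hc) h
      exact mul_nonneg_of_nonpos_of_nonpos (by linarith) (by linarith)
    · have := hanti (Set.mem_Ioi.2 hc) (Set.mem_Ioi.2 hx) h
      exact mul_nonneg (by linarith) (by linarith)
  have hk := hpos _ hc
  have hge : 2 ≤ τ := by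
    have h0 : 0 ≤ ∫ ζ in y..(y + ξ * τ), (ζ - (ξ + y)) * (deriv L (ξ + y) - deriv L ζ) :=
      intervalIntegral.integral_nonneg (by linarith) (fun x hx => hnn x (by linarith [hx.1]))
    rw [hval] at h0
    by_contra! hlt
    have : 0 < deriv L (ξ + y) * (ξ ^ 2 * τ * (2 - τ) / 2) := by
      have : 0 < 2 - τ := by linarith
      positivity
    nlinarith
  refine ⟨hge, fun hstrict => ?_⟩
  have hcb : ξ + y < y + ξ * τ := by nlinarith
  have h1 : 0 ≤ ∫ ζ in y..(ξ + y), (ζ - (ξ + y)) * (deriv L (ξ + y) - deriv L ζ) :=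
    intervalIntegral.integral_nonneg (by linarith) (fun x hx => hnn x (by linarith [hx.1]))
  have h2 : 0 < ∫ ζ in (ξ + y)..(y + ξ * τ), (ζ - (ξ + y)) * (deriv L (ξ + y) - deriv L ζ) := by
    apply intervalIntegral.intervalIntegral_pos_of_pos_on (hI _ _ hc hb) _ hcb
    intro x hx
    have := hstrict (Set.mem_Ioi.2 hc) (Set.mem_Ioi.2 (hc.trans hx.1)) hx.1
    exact mul_pos (by linarith [hx.1]) (by linarith)
  have h3 := intervalIntegral.integral_add_adjacent_intervals (hI _ _ hy hc) (hI _ _ hc hb)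
  rw [hval] at h3
  rcases hge.lt_or_eq with h | h
  · exact h
  · rw [← h] at h3 h2
    norm_num at h3
    linarith
end

section
/- Let L : (0,∞) → ℝ be differentiable, strictly increasing, convex, and satisfy L(y) → ∞ as y → ∞. Then there is no triple τ, ξ, y > 0 satisfying simultaneously Sw(τ,ξ,y) = 0 and Cut(τ,ξ,y) = 0. -/
/-- The cutoff function `Cut(τ,ξ,y) = L(y+ξτ) − L(y) − ξ·L'(y)`. -/
noncomputable def Cut (L : ℝ → ℝ) (τ ξ y : ℝ) : ℝ :=
  L (y + ξ * τ) - L y - ξ * deriv L y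

/-- If `L` is differentiable, strictly increasing and convex on `(0,∞)`,
with `L(y) → ∞` as `y → ∞`, then no triple `τ, ξ, y > 0` satisfies both
`Sw(τ,ξ,y) = 0` and `Cut(τ,ξ,y) = 0`. -/
theorem stmt_3 (L : ℝ → ℝ)
    (hdiff : ∀ y : ℝ, 0 < y → DifferentiableAt ℝ L y)
    (hmono : StrictMonoOn L (Set.Ioi 0))
    (hconv : ConvexOn ℝ (Set.Ioi 0) L)
    (htend : Filter.Tendsto L Filter.atTop Filter.atTop) :
    ¬ ∃ τ ξ y : ℝ, 0 < τ ∧ 0 < ξ ∧ 0 < y ∧ Sw L τ ξ y = 0 ∧ Cut L τ ξ y = 0 := by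
  rintro ⟨τ, ξ, y, hτ, hξ, hy, hS, hC⟩
  unfold Sw at hS
  unfold Cut at hC
  have hh : 0 < ξ * τ := mul_pos hξ hτ
  obtain ⟨b, hb⟩ : ∃ b, b = y + ξ * τ := ⟨_, rfl⟩
  rw [← hb] at hS hC
  have hyb : y < b := by linarith
  have hpos : ∀ x : ℝ, 0 < x → 0 < deriv L x := by
    intro x hx
    have h1 : slope L (x / 2) x ≤ deriv L x :=
      hconv.slope_le_deriv (by simp; linarith) (Set.mem_Ioi.2 hx) (by linarith) (hdiff x hx)
    have h2 : L (x / 2) < L x := hmono (by simp; linarith) (Set.mem_Ioi.2 hx) (by linarith)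
    rw [slope_def_field] at h1
    have h3 : 0 < (L x - L (x / 2)) / (x - x / 2) := div_pos (by linarith) (by linarith)
    linarith
  have hsl : deriv L y ≤ slope L y b :=
    hconv.deriv_le_slope (Set.mem_Ioi.2 hy) (Set.mem_Ioi.2 (hy.trans hyb)) hyb (hdiff y hy)
  rw [slope_def_field, le_div_iff₀ (by linarith)] at hsl
  have hdy := hpos y hy
  have hτ1 : ξ * τ ≤ ξ := by
    by_contra hcon
    push Not at hcon
    nlinarith
  have hmd : MonotoneOn (deriv L) (Set.Ioi 0) :=
    hconv.monotoneOn_deriv (fun x hx => hdiff x hx)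
  have hsub : Set.uIcc y b ⊆ Set.Ioi 0 := by
    rw [Set.uIcc_of_le hyb.le]
    intro x hx
    exact lt_of_lt_of_le hy hx.1
  have hint : IntervalIntegrable (deriv L) MeasureTheory.volume y b :=
    (hmd.mono hsub).intervalIntegrable
  have hint2 : IntervalIntegrable (fun ζ => ζ * deriv L ζ) MeasureTheory.volume y b :=
    hint.continuousOn_mul continuousOn_id
  have hint3 : IntervalIntegrable (fun ζ => b * deriv L ζ) MeasureTheory.volume y b :=
    hint.const_mul b
  have hF : ∫ ζ in y..b, deriv L ζ = L b - L y :=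
    intervalIntegral.integral_deriv_eq_sub (fun x hx => hdiff x (hsub hx)) hint
  have hP : 0 < ∫ ζ in y..b, (b * deriv L ζ - ζ * deriv L ζ) := by
    apply intervalIntegral.intervalIntegral_pos_of_pos_on (hint3.sub hint2) _ hyb
    intro x hx
    have := mul_pos (sub_pos.2 hx.2) (hpos x (hy.trans hx.1))
    linarith
  rw [intervalIntegral.integral_sub hint3 hint2, intervalIntegral.integral_const_mul, hF] at hP
  have hL : L y < L b := hmono (Set.mem_Ioi.2 hy) (Set.mem_Ioi.2 (hy.trans hyb)) hyb
  have : (b - (ξ + y)) * (L b - L y) ≤ 0 :=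
    mul_nonpos_of_nonpos_of_nonneg (by linarith) (by linarith)
  linarith
end

section
/- Let L : (0,∞) → ℝ be continuously differentiable with L'(y) > 0 for all y > 0, L(y) → ∞ as y → ∞, and L(y)/y → 0 as y → ∞. Then for every y > 0 there exist τ, ξ > 0 such that Sw(τ,ξ,y) = 0 and Cut(τ,ξ,y) = 0. -/
/-- If `L` is continuously differentiable on `(0,∞)` with `L' > 0`,
`L(y) → ∞` and `L(y)/y → 0` as `y → ∞`, then for every `y > 0` there exist
`τ, ξ > 0` with `Sw(τ,ξ,y) = 0` and `Cut(τ,ξ,y) = 0`. -/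
theorem stmt_4 (L : ℝ → ℝ)
    (hdiff : ∀ y : ℝ, 0 < y → DifferentiableAt ℝ L y)
    (hcont : ContinuousOn (deriv L) (Set.Ioi 0))
    (hpos : ∀ y : ℝ, 0 < y → 0 < deriv L y)
    (htend : Filter.Tendsto L Filter.atTop Filter.atTop)
    (hsub : Filter.Tendsto (fun y => L y / y) Filter.atTop (nhds 0)) :
    ∀ y : ℝ, 0 < y → ∃ τ ξ : ℝ, 0 < τ ∧ 0 < ξ ∧ Sw L τ ξ y = 0 ∧ Cut L τ ξ y = 0 := by
  intro y hy
  have hc : 0 < deriv L y := hpos y hy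
  obtain ⟨c, hcdef⟩ : ∃ c, c = deriv L y := ⟨_, rfl⟩
  rw [← hcdef] at hc
  have hLd : ∀ w, 0 < w → HasDerivAt L (deriv L w) w := fun w hw => (hdiff w hw).hasDerivAt
  have hmono : StrictMonoOn L (Set.Ioi 0) := by
    apply strictMonoOn_of_deriv_pos (convex_Ioi 0)
    · exact fun w hw => (hdiff w hw).continuousAt.continuousWithinAt
    · intro w hw
      rw [interior_Ioi] at hw
      exact hpos w hw
  have hfc : ContinuousOn (fun ζ => ζ * deriv L ζ) (Set.Ioi 0) := continuousOn_id.mul hcont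
  obtain ⟨G, hG⟩ : ∃ G : ℝ → ℝ, G = fun w => (∫ ζ in y..w, ζ * deriv L ζ) - y * (L w - L y)
      - (L w - L y) ^ 2 / c := ⟨_, rfl⟩
  obtain ⟨g, hg⟩ : ∃ g : ℝ → ℝ, g = fun w => w - y - 2 * (L w - L y) / c := ⟨_, rfl⟩
  have hGd : ∀ w, y ≤ w → HasDerivAt G (g w * deriv L w) w := by
    intro w hw
    have hw0 : 0 < w := lt_of_lt_of_le hy hw
    have h1 : HasDerivAt (fun w => ∫ ζ in y..w, ζ * deriv L ζ) (w * deriv L w) w := by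
      apply intervalIntegral.integral_hasDerivAt_right
      · apply ContinuousOn.intervalIntegrable
        apply hfc.mono
        rw [Set.uIcc_of_le hw]
        exact fun x hx => lt_of_lt_of_le hy hx.1
      · exact hfc.stronglyMeasurableAtFilter isOpen_Ioi w hw0
      · exact hfc.continuousAt (isOpen_Ioi.mem_nhds hw0)
    have h2 := (hLd w hw0).sub_const (L y)
    rw [hG, hg]
    refine ((h1.sub (h2.const_mul y)).sub ((h2.pow 2).div_const c)).congr_deriv ?_
    push_cast
    field_simp
  have hG0 : G y = 0 := by simp [hG]
  have hgd : HasDerivAt g (-1) y := by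
    have h2 := (((hLd y hy).sub_const (L y)).const_mul 2).div_const c
    have h3 := ((hasDerivAt_id y).sub_const y).sub h2
    rw [hg]
    refine h3.congr_deriv ?_
    rw [← hcdef]
    field_simp
    norm_num
  have hg0 : g y = 0 := by simp [hg]
  -- negative near y
  obtain ⟨a, hya, hGa⟩ : ∃ a, y < a ∧ G a < 0 := by
    have h1 : ∀ᶠ w in nhdsWithin y (Set.Ioi y), g w < 0 := by
      have h := (hasDerivAt_iff_tendsto_slope.1 hgd).mono_left
        (nhdsWithin_mono y (fun x (hx : y < x) => ne_of_gt hx))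
      filter_upwards [h.eventually (gt_mem_nhds (show (-1 : ℝ) < 0 by norm_num)),
        self_mem_nhdsWithin] with w hw hyw
      rw [slope_def_field, hg0, sub_zero] at hw
      have hyw' : 0 < w - y := sub_pos.2 hyw
      by_contra hcon
      exact absurd hw (not_lt.2 (div_nonneg (not_lt.1 hcon) hyw'.le))
    obtain ⟨a, hya, ha⟩ := mem_nhdsGT_iff_exists_Ioo_subset.1 h1
    have hya' : y < a := hya
    refine ⟨(y + a) / 2, by linarith, ?_⟩
    have hanti : StrictAntiOn G (Set.Icc y ((y + a) / 2)) := by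
      apply strictAntiOn_of_deriv_neg (convex_Icc _ _)
      · exact fun w hw => (hGd w hw.1).continuousAt.continuousWithinAt
      · intro w hw
        rw [interior_Icc] at hw
        rw [(hGd w hw.1.le).deriv]
        have hw2 := hw.2
        exact mul_neg_of_neg_of_pos (ha ⟨hw.1, by linarith⟩) (hpos w (hy.trans hw.1))
    have := hanti (Set.left_mem_Icc.2 (by linarith)) (Set.right_mem_Icc.2 (by linarith))
      (show y < (y + a) / 2 by linarith)
    linarith
  -- positive far away
  obtain ⟨b, hab, hGb⟩ : ∃ b, a ≤ b ∧ 0 < G b := by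
    have h1 : ∀ᶠ w in Filter.atTop, 1 ≤ g w := by
      filter_upwards [hsub.eventually (gt_mem_nhds (show (0 : ℝ) < c / 4 by positivity)),
        Filter.eventually_gt_atTop 0,
        Filter.eventually_ge_atTop (2 * (y + 1 - 2 * L y / c))] with w hw hw0 hw1
      rw [div_lt_iff₀ hw0] at hw
      have h2 : 2 * L w / c ≤ w / 2 := by
        rw [div_le_iff₀ hc]; linarith
      have h3 : g w = w - y - 2 * L w / c + 2 * L y / c := by rw [hg]; ring
      rw [h3]; linarith
    obtain ⟨A, hA⟩ := Filter.eventually_atTop.1 h1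
    have hm : MonotoneOn (fun w => G w - L w) (Set.Ici (max A a)) := by
      have hd : ∀ w, max A a ≤ w → HasDerivAt (fun w => G w - L w)
          (g w * deriv L w - deriv L w) w := fun w hw =>
        (hGd w (hya.le.trans ((le_max_right _ _).trans hw))).sub
          (hLd w ((hy.trans hya).trans_le ((le_max_right _ _).trans hw)))
      apply monotoneOn_of_deriv_nonneg (convex_Ici _)
      · exact fun w hw => (hd w hw).continuousAt.continuousWithinAt
      · intro w hw
        rw [interior_Ici] at hw
        exact (hd w hw.le).differentiableAt.differentiableWithinAt
      · intro w hw
        rw [interior_Ici] at hw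
        have hw' : max A a < w := hw
        rw [(hd w hw'.le).deriv]
        have h4 := hA w ((le_max_left _ _).trans hw'.le)
        have h5 := hpos w ((hy.trans hya).trans_le ((le_max_right _ _).trans hw'.le))
        nlinarith
    obtain ⟨b, hb1, hb2⟩ := ((htend.eventually_gt_atTop
      (L (max A a) - G (max A a))).and (Filter.eventually_ge_atTop (max A a))).exists
    refine ⟨b, (le_max_right _ _).trans hb2, ?_⟩
    have h6 := hm (Set.self_mem_Ici) (show b ∈ Set.Ici (max A a) from hb2) hb2
    simp only at h6
    linarith
  have hGc : ContinuousOn G (Set.Icc a b) := fun w hw =>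
    (hGd w (hya.le.trans hw.1)).continuousAt.continuousWithinAt
  obtain ⟨w, hw, hGw⟩ := intermediate_value_Icc hab hGc ⟨hGa.le, hGb.le⟩
  have hyw : y < w := hya.trans_le hw.1
  have hM : 0 < L w - L y := sub_pos.2 (hmono hy (hy.trans hyw) hyw)
  have hξ : 0 < (L w - L y) / c := div_pos hM hc
  have hyw' : y + (L w - L y) / c * ((w - y) / ((L w - L y) / c)) = w := by
    rw [mul_div_cancel₀ _ hξ.ne']; ring
  refine ⟨(w - y) / ((L w - L y) / c), (L w - L y) / c, div_pos (sub_pos.2 hyw) hξ, hξ, ?_, ?_⟩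
  · unfold Sw
    rw [hyw', ← hGw, hG]
    ring
  · unfold Cut
    rw [hyw', ← hcdef]
    field_simp
    ring
end

section
/- Let L : (0,∞) → ℝ be continuously differentiable with L'(y) > 0 for all y > 0, L(y) → ∞ as y → ∞, L(y)/y → 0 as y → ∞, and L strictly concave. Then for every y > 0 there is exactly one pair (τ, ξ) with τ, ξ > 0 such that Sw(τ,ξ,y) = 0 and Cut(τ,ξ,y) = 0. -/
/-- If `L` is continuously differentiable on `(0,∞)` with `L' > 0`,
`L(y) → ∞`, `L(y)/y → 0` as `y → ∞`, and `L` strictly concave, then for every `y > 0`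
there is exactly one pair `(τ, ξ)` with `τ, ξ > 0`, `Sw(τ,ξ,y) = 0` and `Cut(τ,ξ,y) = 0`. -/
theorem stmt_5 (L : ℝ → ℝ)
    (hdiff : ∀ y : ℝ, 0 < y → DifferentiableAt ℝ L y)
    (hcont : ContinuousOn (deriv L) (Set.Ioi 0))
    (hpos : ∀ y : ℝ, 0 < y → 0 < deriv L y)
    (htend : Filter.Tendsto L Filter.atTop Filter.atTop)
    (hsub : Filter.Tendsto (fun y => L y / y) Filter.atTop (nhds 0))
    (hconc : StrictConcaveOn ℝ (Set.Ioi 0) L) :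
    ∀ y : ℝ, 0 < y →
      ∃! p : ℝ × ℝ, 0 < p.1 ∧ 0 < p.2 ∧ Sw L p.1 p.2 y = 0 ∧ Cut L p.1 p.2 y = 0 := by
  intro y hy
  have ha := hpos y hy
  set a := deriv L y with ha_def
  have hL : ∀ z, 0 < z → HasDerivAt L (deriv L z) z := fun z hz => (hdiff z hz).hasDerivAt
  have hcm : ContinuousOn (fun ζ => ζ * deriv L ζ) (Set.Ioi 0) := continuousOn_id.mul hcont
  have hF : ∀ z, y ≤ z →
      HasDerivAt (fun z => ∫ ζ in y..z, ζ * deriv L ζ) (z * deriv L z) z := by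
    intro z hz
    have hz0 : 0 < z := lt_of_lt_of_le hy hz
    apply intervalIntegral.integral_hasDerivAt_right
    · apply ContinuousOn.intervalIntegrable
      apply hcm.mono
      intro w hw
      rw [Set.uIcc_of_le hz] at hw
      exact lt_of_lt_of_le hy hw.1
    · exact hcm.stronglyMeasurableAtFilter isOpen_Ioi z hz0
    · exact hcm.continuousAt (Ioi_mem_nhds hz0)
  obtain ⟨G, hG⟩ : ∃ G : ℝ → ℝ, G = fun z => (∫ ζ in y..z, ζ * deriv L ζ)
      - ((L z - L y) / a + y) * (L z - L y) := ⟨_, rfl⟩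
  have hGd : ∀ z, y ≤ z →
      HasDerivAt G (deriv L z * ((z - y) - 2 * (L z - L y) / a)) z := by
    intro z hz
    have h1 := (hL z (lt_of_lt_of_le hy hz)).sub_const (L y)
    have h2 := (hF z hz).sub (((h1.div_const a).add_const y).mul h1)
    rw [hG]
    refine HasDerivAt.congr_deriv h2 ?_
    simp only [div_eq_mul_inv]
    ring
  have hGc : ∀ s : Set ℝ, s ⊆ Set.Ici y → ContinuousOn G s := fun s hs z hz =>
    (hGd z (hs hz)).continuousAt.continuousWithinAt
  have hGy : G y = 0 := by rw [hG]; simp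
  have hmono : StrictMonoOn L (Set.Ioi 0) := by
    apply strictMonoOn_of_deriv_pos (convex_Ioi 0)
    · exact fun z hz => (hdiff z hz).continuousAt.continuousWithinAt
    · intro z hz
      rw [interior_Ioi] at hz
      exact hpos z hz
  have hD : ∀ z, y < z → 0 < L z - L y := fun z hz =>
    sub_pos.2 (hmono hy (hy.trans hz) hz)
  -- uniqueness
  have huniq : ∀ z1 z2, y < z1 → z1 < z2 → G z1 = 0 → G z2 = 0 → False := by
    intro z1 z2 h1 h2 e1 e2
    obtain ⟨c1, hc1, d1⟩ := exists_hasDerivAt_eq_zero h1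
      (hGc _ (fun w hw => hw.1)) (hGy.trans e1.symm) (fun w hw => hGd w hw.1.le)
    obtain ⟨c2, hc2, d2⟩ := exists_hasDerivAt_eq_zero h2
      (hGc _ (fun w hw => h1.le.trans hw.1)) (e1.trans e2.symm)
      (fun w hw => hGd w (h1.le.trans hw.1.le))
    have p1 : y < c1 := hc1.1
    have p2 : c1 < c2 := hc1.2.trans hc2.1
    have d1 := (mul_eq_zero.1 d1).resolve_left (hpos c1 (hy.trans p1)).ne'
    have d2 := (mul_eq_zero.1 d2).resolve_left (hpos c2 (hy.trans (p1.trans p2))).ne'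
    have hs := hconc.slope_anti_adjacent (x := y) (y := c1) (z := c2) hy
      (hy.trans (p1.trans p2)) p1 p2
    field_simp at d1 d2
    have q1 : L c1 - L y = a / 2 * (c1 - y) := by linarith
    have q2 : L c2 - L c1 = a / 2 * (c2 - c1) := by linarith
    rw [q1, q2, mul_div_cancel_right₀ _ (sub_pos.2 p1).ne',
      mul_div_cancel_right₀ _ (sub_pos.2 p2).ne'] at hs
    exact lt_irrefl _ hs
  -- negativity near y
  have hneg : ∃ z, y < z ∧ G z < 0 := by
    have hs := (hasDerivAt_iff_tendsto_slope.1 (hL y hy)).mono_left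
      (nhdsWithin_mono y (show Set.Ioi y ⊆ {y}ᶜ from fun w hw => ne_of_gt hw))
    have hev := hs.eventually (lt_mem_nhds (show a / 2 < deriv L y by linarith))
    obtain ⟨u, hu, hsub'⟩ := mem_nhdsGT_iff_exists_Ioo_subset.1 hev
    have hu : y < u := hu
    obtain ⟨m, hm1, hm2⟩ := exists_between hu
    refine ⟨m, hm1, ?_⟩
    obtain ⟨c, hc, hce⟩ := exists_hasDerivAt_eq_slope G _ hm1
      (hGc _ (fun w hw => hw.1)) (fun w hw => hGd w hw.1.le)
    have hcs : a / 2 < slope L y c := hsub' ⟨hc.1, hc.2.trans hm2⟩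
    rw [slope_def_field, lt_div_iff₀ (sub_pos.2 hc.1)] at hcs
    have hH : (c - y) - 2 * (L c - L y) / a < 0 := by
      rw [sub_neg, lt_div_iff₀ ha]
      linarith
    have hneg := mul_neg_of_pos_of_neg (hpos c (hy.trans hc.1)) hH
    rw [hce, hGy, sub_zero] at hneg
    by_contra hcon
    exact absurd hneg (not_lt.2 (div_nonneg (not_lt.1 hcon) (sub_pos.2 hm1).le))
  obtain ⟨z1, hz1, hGz1⟩ := hneg
  -- positivity far away
  have hpos' : ∃ z, z1 < z ∧ 0 < G z := by
    have e1 := hsub.eventually (gt_mem_nhds (show (0:ℝ) < a / 4 by linarith))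
    have e2 := Filter.eventually_ge_atTop (max (z1 + 1) (2 * (y + 1 - 2 * L y / a)))
    obtain ⟨M, hM⟩ := Filter.eventually_atTop.1 (e1.and e2)
    have hM1 : z1 + 1 ≤ M := (le_max_left _ _).trans (hM M le_rfl).2
    have hH : ∀ z, M ≤ z → 1 ≤ (z - y) - 2 * (L z - L y) / a := by
      intro z hz
      obtain ⟨h1, h2⟩ := hM z hz
      have h3 := (le_max_right _ _).trans h2
      have hz0 : 0 < z := by linarith
      rw [div_lt_iff₀ hz0] at h1
      have h4 : 2 * L z / a ≤ z / 2 := by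
        rw [div_le_iff₀ ha]; linarith
      have h5 : 2 * (L z - L y) / a = 2 * L z / a - 2 * L y / a := by ring
      rw [h5]; linarith
    have hmon : MonotoneOn (fun z => G z - L z) (Set.Ici M) := by
      have hd : ∀ z, M ≤ z → HasDerivAt (fun z => G z - L z)
          (deriv L z * ((z - y) - 2 * (L z - L y) / a) - deriv L z) z := fun z hz =>
        (hGd z (by linarith)).sub (hL z (by linarith))
      apply monotoneOn_of_deriv_nonneg (convex_Ici M)
      · exact fun z hz => (hd z hz).continuousAt.continuousWithinAt
      · intro z hz
        rw [interior_Ici] at hz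
        exact (hd z (le_of_lt hz)).differentiableAt.differentiableWithinAt
      · intro z hz
        rw [interior_Ici] at hz
        have hz : M < z := hz
        rw [(hd z hz.le).deriv]
        nlinarith [hH z hz.le, hpos z (by linarith)]
    obtain ⟨z, hz1', hz2⟩ := ((htend.eventually_gt_atTop (L M - G M)).and
      (Filter.eventually_ge_atTop M)).exists
    refine ⟨z, by linarith, ?_⟩
    have := hmon (Set.mem_Ici.2 le_rfl) (Set.mem_Ici.2 hz2) hz2
    simp only at this
    linarith
  obtain ⟨z2, hz2, hGz2⟩ := hpos'
  obtain ⟨z, hz, hGz⟩ := intermediate_value_Icc hz2.le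
    (hGc _ (fun w hw => hz1.le.trans hw.1)) ⟨hGz1.le, hGz2.le⟩
  have hyz : y < z := hz1.trans_le hz.1
  have hDz := hD z hyz
  have hξ : 0 < (L z - L y) / a := div_pos hDz ha
  have hkey : ∀ τ ξ, 0 < τ → 0 < ξ → Sw L τ ξ y = 0 → Cut L τ ξ y = 0 →
      ξ = (L (y + ξ * τ) - L y) / a ∧ G (y + ξ * τ) = 0 := by
    intro τ ξ hτ hξ hS hC
    unfold Sw at hS
    unfold Cut at hC
    have h1 : ξ = (L (y + ξ * τ) - L y) / a := by
      rw [eq_div_iff ha.ne']; linarith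
    refine ⟨h1, ?_⟩
    rw [hG]
    simp only
    rw [← h1]
    exact hS
  refine ⟨((z - y) / ((L z - L y) / a), (L z - L y) / a),
    ⟨div_pos (sub_pos.2 hyz) hξ, hξ, ?_, ?_⟩, ?_⟩
  · simp only [Sw]
    rw [mul_div_cancel₀ _ hξ.ne', add_sub_cancel]
    rw [hG] at hGz
    exact hGz
  · simp only [Cut]
    rw [mul_div_cancel₀ _ hξ.ne', add_sub_cancel, ← ha_def, div_mul_cancel₀ _ ha.ne', sub_self]
  · rintro ⟨τ, ξ⟩ ⟨hτ, hξ', hS, hC⟩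
    simp only at hτ hξ' hS hC
    obtain ⟨k1, k2⟩ := hkey τ ξ hτ hξ' hS hC
    have hlt : y < y + ξ * τ := by have := mul_pos hξ' hτ; linarith
    have hzz : y + ξ * τ = z := by
      rcases lt_trichotomy (y + ξ * τ) z with h | h | h
      · exact (huniq _ _ hlt h k2 hGz).elim
      · exact h
      · exact (huniq _ _ hyz h hGz k2).elim
    rw [hzz] at k1
    have k3 : τ = (z - y) / ((L z - L y) / a) := by
      rw [← k1, eq_div_iff hξ'.ne']; linarith
    exact Prod.ext k3 k1
end

section
/- Let α ≥ 1 be a real number. Then for every r > 0 one has (1+αr)^{1/α} < 1 + r + r²/(1+αr). Consequently, the cutoff system for α has no solution with r, τ > 0. -/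
/-- For `α ≥ 1` and every `r > 0`,
`(1+αr)^{1/α} < 1 + r + r²/(1+αr)`; consequently the cutoff system
`τ = 1 + r/(1+αr)`, `1+αr = (1+rτ)^α` has no solution with `r, τ > 0`. -/
theorem stmt_6 (α : ℝ) (hα : 1 ≤ α) :
    (∀ r : ℝ, 0 < r → (1 + α * r) ^ (1 / α) < 1 + r + r ^ 2 / (1 + α * r)) ∧
    ¬ ∃ r τ : ℝ, 0 < r ∧ 0 < τ ∧ τ = 1 + r / (1 + α * r) ∧
      1 + α * r = (1 + r * τ) ^ α := by
  have h0 : 0 < α := by linarith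
  have key : ∀ r : ℝ, 0 < r → (1 + α * r) ^ (1 / α) < 1 + r + r ^ 2 / (1 + α * r) := by
    intro r hr
    have hb : 1 + α * r ≤ (1 + r) ^ α :=
      one_add_mul_self_le_rpow_one_add (by linarith) hα
    have hp : 0 < 1 + α * r := by positivity
    have h1 : (1 + α * r) ^ (1 / α) ≤ ((1 + r) ^ α) ^ (1 / α) :=
      Real.rpow_le_rpow hp.le hb (by positivity)
    rw [← Real.rpow_mul (by positivity), mul_one_div_cancel h0.ne', Real.rpow_one] at h1
    have h2 : 0 < r ^ 2 / (1 + α * r) := by positivity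
    linarith
  refine ⟨key, ?_⟩
  rintro ⟨r, τ, hr, hτ, e1, e2⟩
  have h := key r hr
  have h3 : 1 + r + r ^ 2 / (1 + α * r) = 1 + r * τ := by
    rw [e1]; ring
  have h4 : (1 + α * r) ^ (1 / α) = 1 + r * τ := by
    rw [e2, ← Real.rpow_mul (by positivity), mul_one_div_cancel h0.ne', Real.rpow_one]
  rw [h3, h4] at h
  exact lt_irrefl _ h
end

section
/- Let 0 < α < 1. Then there exists a unique r_c > 0 with (1+αr_c)^{1/α} = 1 + r_c + r_c²/(1+αr_c). Moreover r_c ≥ 1/(1−α), and τ_c := 1 + r_c/(1+αr_c) satisfies τ_c ≥ 2; in particular (r_c, τ_c) is the unique positive solution of the cutoff system for α. -/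
noncomputable def ctf (α r : ℝ) : ℝ :=
  (1 / α + 1) * Real.log (1 + α * r) - Real.log (1 + (1 + α) * r + (1 + α) * r ^ 2)

lemma ctf_hasDeriv (α : ℝ) (hα0 : 0 < α) (r : ℝ) (hr : 0 ≤ r) :
    HasDerivAt (ctf α) ((1 + α) * (r * ((1 - α) * r - 1)) /
      ((1 + α * r) * (1 + (1 + α) * r + (1 + α) * r ^ 2))) r := by
  have hu : 0 < 1 + α * r := by positivity
  have hQ : 0 < 1 + (1 + α) * r + (1 + α) * r ^ 2 := by positivity
  have h1 : HasDerivAt (fun r : ℝ => 1 + α * r) α r := by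
    simpa using ((hasDerivAt_id r).const_mul α).const_add 1
  have h2 : HasDerivAt (fun r : ℝ => 1 + (1 + α) * r + (1 + α) * r ^ 2)
      ((1 + α) + (1 + α) * (2 * r)) r := by
    have a := ((hasDerivAt_id r).const_mul (1 + α)).const_add 1
    have b := (hasDerivAt_pow 2 r).const_mul (1 + α)
    refine HasDerivAt.congr_deriv (a.add b) ?_
    simp
  have h3 := ((h1.log hu.ne').const_mul (1 / α + 1)).sub (h2.log hQ.ne')
  refine HasDerivAt.congr_deriv h3 ?_
  field_simp
  ring

lemma ctf_iff (α : ℝ) (hα0 : 0 < α) (r : ℝ) (hr : 0 < r) :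
    (1 + α * r) ^ (1 / α) = 1 + r + r ^ 2 / (1 + α * r) ↔ ctf α r = 0 := by
  have hu : 0 < 1 + α * r := by positivity
  have hQ : 0 < 1 + (1 + α) * r + (1 + α) * r ^ 2 := by positivity
  have e : 1 + r + r ^ 2 / (1 + α * r) =
      (1 + (1 + α) * r + (1 + α) * r ^ 2) / (1 + α * r) := by
    field_simp
    ring
  have hp : 0 < (1 + α * r) ^ (1 / α) := Real.rpow_pos_of_pos hu _
  rw [e, ← Real.log_injOn_pos.eq_iff (Set.mem_Ioi.2 hp) (Set.mem_Ioi.2 (div_pos hQ hu)),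
    Real.log_rpow hu, Real.log_div hQ.ne' hu.ne', ctf]
  constructor <;> intro h <;> linarith

lemma ctf_exists (α : ℝ) (hα0 : 0 < α) (hα1 : α < 1) : ∃ r : ℝ, 0 < r ∧ 0 ≤ ctf α r := by
  have hk : 0 < 1 / α - 1 := by
    rw [sub_pos, lt_div_iff₀ hα0]; linarith
  have hL : 0 < Real.log (2 / α ^ 2) := by
    apply Real.log_pos
    rw [lt_div_iff₀ (by positivity)]; nlinarith
  obtain ⟨L, hLd⟩ : ∃ L, L = Real.log (2 / α ^ 2) / (1 / α - 1) := ⟨_, rfl⟩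
  have hLp : 0 < L := hLd ▸ div_pos hL hk
  have hLe : (1 / α - 1) * L = Real.log (2 / α ^ 2) := by
    rw [hLd, mul_comm, div_mul_cancel₀ _ hk.ne']
  have h1 : 1 < Real.exp L := Real.one_lt_exp_iff.2 hLp
  obtain ⟨r, hr⟩ : ∃ r, r = (Real.exp L - 1) / α := ⟨_, rfl⟩
  have hr0 : 0 < r := hr ▸ div_pos (by linarith) hα0
  have hu : 1 + α * r = Real.exp L := by rw [hr]; field_simp; ring
  refine ⟨r, hr0, ?_⟩
  have hlu : Real.log (1 + α * r) = L := by rw [hu, Real.log_exp]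
  have hup : 0 < 1 + α * r := by positivity
  have hQ : 0 < 1 + (1 + α) * r + (1 + α) * r ^ 2 := by positivity
  have hb : 1 + (1 + α) * r + (1 + α) * r ^ 2 ≤ 2 / α ^ 2 * (1 + α * r) ^ 2 := by
    have a1 : α * (1 + r) ≤ 1 + α * r := by linarith
    have a2 : (α * (1 + r)) ^ 2 ≤ (1 + α * r) ^ 2 := by gcongr
    rw [div_mul_eq_mul_div, le_div_iff₀ (by positivity)]
    have a3 : 1 + (1 + α) * r + (1 + α) * r ^ 2 ≤ 2 * (1 + r) ^ 2 := by nlinarith [sq_nonneg r]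
    calc _ ≤ 2 * (1 + r) ^ 2 * α ^ 2 := by gcongr
      _ ≤ _ := by linarith
  have hl := Real.log_le_log hQ hb
  rw [Real.log_mul (by positivity) (by positivity), Real.log_pow, hlu] at hl
  push_cast at hl
  rw [ctf, hlu]
  linarith

/-- For `0 < α < 1` there is a unique `r_c > 0` with
`(1+αr_c)^{1/α} = 1 + r_c + r_c²/(1+αr_c)`; moreover `r_c ≥ 1/(1−α)` and
`τ_c := 1 + r_c/(1+αr_c)` satisfies `τ_c ≥ 2`, and `(r_c, τ_c)` is the unique
positive solution of the cutoff system `τ = 1 + r/(1+αr)`, `1+αr = (1+rτ)^α`. -/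
theorem stmt_7 (α : ℝ) (hα0 : 0 < α) (hα1 : α < 1) :
    ∃ r_c : ℝ, 0 < r_c ∧
      (1 + α * r_c) ^ (1 / α) = 1 + r_c + r_c ^ 2 / (1 + α * r_c) ∧
      (∀ r : ℝ, 0 < r →
        (1 + α * r) ^ (1 / α) = 1 + r + r ^ 2 / (1 + α * r) → r = r_c) ∧
      1 / (1 - α) ≤ r_c ∧
      2 ≤ 1 + r_c / (1 + α * r_c) ∧
      1 + α * r_c = (1 + r_c * (1 + r_c / (1 + α * r_c))) ^ α ∧
      (∀ r τ : ℝ, 0 < r → 0 < τ → τ = 1 + r / (1 + α * r) →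
        1 + α * r = (1 + r * τ) ^ α → r = r_c ∧ τ = 1 + r_c / (1 + α * r_c)) := by
  have h1α : 0 < 1 - α := by linarith
  obtain ⟨m, hm⟩ : ∃ m, m = 1 / (1 - α) := ⟨_, rfl⟩
  have hm0 : 0 < m := hm ▸ by positivity
  have hmm : (1 - α) * m = 1 := by rw [hm]; field_simp
  have hcont : ContinuousOn (ctf α) (Set.Ici 0) := fun x hx =>
    (ctf_hasDeriv α hα0 x hx).continuousAt.continuousWithinAt
  have hanti : StrictAntiOn (ctf α) (Set.Icc 0 m) := by
    apply strictAntiOn_of_deriv_neg (convex_Icc _ _) (hcont.mono Set.Icc_subset_Ici_self)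
    intro x hx
    rw [interior_Icc] at hx
    have hx0 := hx.1
    rw [(ctf_hasDeriv α hα0 x hx0.le).deriv]
    apply div_neg_of_neg_of_pos _ (by positivity)
    have : (1 - α) * x < (1 - α) * m := mul_lt_mul_of_pos_left hx.2 h1α
    exact mul_neg_of_pos_of_neg (by positivity) (mul_neg_of_pos_of_neg hx0 (by linarith))
  have hmono : StrictMonoOn (ctf α) (Set.Ici m) := by
    apply strictMonoOn_of_deriv_pos (convex_Ici _) (hcont.mono (Set.Ici_subset_Ici.2 hm0.le))
    intro x hx
    rw [interior_Ici] at hx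
    have hx' : m < x := hx
    have hx0 : 0 < x := hm0.trans hx'
    rw [(ctf_hasDeriv α hα0 x hx0.le).deriv]
    apply div_pos _ (by positivity)
    have : (1 - α) * m < (1 - α) * x := mul_lt_mul_of_pos_left hx' h1α
    exact mul_pos (by positivity) (mul_pos hx0 (by linarith))
  have hf0 : ctf α 0 = 0 := by simp [ctf]
  have hneg : ∀ r, 0 < r → r ≤ m → ctf α r < 0 := fun r h0 h1 => by
    have := hanti ⟨le_rfl, hm0.le⟩ ⟨h0.le, h1⟩ h0
    linarith
  obtain ⟨R, hR0, hR⟩ := ctf_exists α hα0 hα1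
  have hmR : m ≤ R := by
    by_contra h
    have := hneg R hR0 (not_le.1 h).le
    linarith
  obtain ⟨c, hc, hfc⟩ := intermediate_value_Icc hmR
    (hcont.mono (fun x hx => hm0.le.trans hx.1)) (show (0 : ℝ) ∈ _ from
      ⟨(hneg m hm0 le_rfl).le, hR⟩)
  have hc0 : 0 < c := hm0.trans_le hc.1
  have huniq : ∀ r : ℝ, 0 < r →
        (1 + α * r) ^ (1 / α) = 1 + r + r ^ 2 / (1 + α * r) → r = c := by
    intro r hr h
    rw [ctf_iff α hα0 r hr] at h
    have hmr : m ≤ r := by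
      by_contra h'
      have := hneg r hr (not_le.1 h').le
      linarith
    exact hmono.injOn hmr hc.1 (h.trans hfc.symm)
  have hceq := (ctf_iff α hα0 c hc0).2 hfc
  have hX : ∀ r : ℝ, 1 + r * (1 + r / (1 + α * r)) = 1 + r + r ^ 2 / (1 + α * r) := by
    intro r; ring
  have huc : 0 < 1 + α * c := by positivity
  refine ⟨c, hc0, hceq, huniq, hm ▸ hc.1, ?_, ?_, ?_⟩
  · have : 1 ≤ c / (1 + α * c) := by
      rw [le_div_iff₀ huc]
      have := mul_le_mul_of_nonneg_left hc.1 h1α.le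
      linarith
    linarith
  · rw [hX, ← hceq, ← Real.rpow_mul huc.le, one_div_mul_cancel hα0.ne', Real.rpow_one]
  · intro r τ hr hτ h1 h2
    have hrc : r = c := by
      apply huniq r hr
      rw [← hX, ← h1, h2, ← Real.rpow_mul (by positivity), mul_one_div_cancel hα0.ne',
        Real.rpow_one]
    exact ⟨hrc, hrc ▸ h1⟩
end

section
/- Let α < 0 with α ≠ −1. Then there exists a unique r_c with 0 < r_c < −1/α satisfying (1+αr_c)^{1/α} = 1 + r_c + r_c²/(1+αr_c). Moreover 1/(1−α) ≤ r_c < −1/α, and τ_c := 1 + r_c/(1+αr_c) satisfies τ_c ≥ 2; in particular (r_c, τ_c) solves the cutoff system for α. -/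
open Real Set Filter Topology

theorem aux_N (a r : ℝ) (hr : 0 ≤ r) (hu : 0 < 1 + a * r) :
    0 < 1 + (1 + a) * r + (1 + a) * r ^ 2 := by
  nlinarith [mul_nonneg hr hu.le, sq_nonneg r]

theorem aux_eq (a r : ℝ) (hu : 0 < 1 + a * r) :
    1 + r + r ^ 2 / (1 + a * r) = (1 + (1 + a) * r + (1 + a) * r ^ 2) / (1 + a * r) := by
  have h := hu.ne'
  rw [eq_div_iff h, add_mul, div_mul_cancel₀ _ h]
  ring

noncomputable def auxH (a r : ℝ) : ℝ :=
  log (1 + (1 + a) * r + (1 + a) * r ^ 2) / (1 + a) - log (1 + a * r) / a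

theorem aux_iff (a r : ℝ) (ha : a ≠ 0) (ha1 : 1 + a ≠ 0) (hr : 0 ≤ r) (hu : 0 < 1 + a * r) :
    (1 + a * r) ^ (1 / a) = 1 + r + r ^ 2 / (1 + a * r) ↔ auxH a r = 0 := by
  have hN := aux_N a r hr hu
  rw [aux_eq a r hu]
  have h1 : 0 < (1 + a * r) ^ (1 / a) := rpow_pos_of_pos hu _
  rw [← Real.log_injOn_pos.eq_iff (mem_Ioi.2 h1) (mem_Ioi.2 (div_pos hN hu)),
    log_rpow hu, log_div hN.ne' hu.ne', auxH]
  generalize log (1 + (1 + a) * r + (1 + a) * r ^ 2) = x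
  generalize log (1 + a * r) = y
  field_simp
  constructor <;> intro h <;> linarith

theorem aux_deriv (a r : ℝ) (ha : a ≠ 0) (ha1 : 1 + a ≠ 0) (hr : 0 ≤ r) (hu : 0 < 1 + a * r) :
    HasDerivAt (auxH a) (r * (1 - (1 - a) * r) /
      ((1 + (1 + a) * r + (1 + a) * r ^ 2) * (1 + a * r))) r := by
  have hN := aux_N a r hr hu
  have d1 : HasDerivAt (fun r : ℝ => 1 + (1 + a) * r + (1 + a) * r ^ 2)
      ((1 + a) * 1 + (1 + a) * (2 * r)) r := by
    have := (((hasDerivAt_id r).const_mul (1 + a)).const_add 1).add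
      ((hasDerivAt_pow 2 r).const_mul (1 + a))
    exact this.congr_deriv (by norm_num)
  have d2 : HasDerivAt (fun r : ℝ => 1 + a * r) (a * 1) r :=
    ((hasDerivAt_id r).const_mul a).const_add 1
  have := ((d1.log hN.ne').div_const (1 + a)).sub ((d2.log hu.ne').div_const a)
  refine HasDerivAt.congr_deriv (f := auxH a) this (Eq.symm ?_)
  have h1 := hN.ne'
  have h2 := hu.ne'
  rw [eq_sub_iff_add_eq]
  have e1 : ((1 + a) * 1 + (1 + a) * (2 * r)) / (1 + (1 + a) * r + (1 + a) * r ^ 2) / (1 + a)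
     = (1 + 2 * r) / (1 + (1 + a) * r + (1 + a) * r ^ 2) := by
    rw [div_div, div_eq_div_iff (mul_ne_zero h1 ha1) h1]; ring
  have e2 : a * 1 / (1 + a * r) / a = 1 / (1 + a * r) := by
    rw [div_div, div_eq_div_iff (mul_ne_zero h2 ha) h2]; ring
  rw [e1, e2, div_add_div _ _ (mul_ne_zero h1 h2) h2,
    div_eq_div_iff (mul_ne_zero (mul_ne_zero h1 h2) h2) h1]
  ring

/-- For `α < 0`, `α ≠ −1`, there is a unique `r_c` with
`0 < r_c < −1/α` satisfying `(1+αr_c)^{1/α} = 1 + r_c + r_c²/(1+αr_c)`;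
moreover `1/(1−α) ≤ r_c < −1/α` and `τ_c := 1 + r_c/(1+αr_c)` satisfies
`τ_c ≥ 2`, and `(r_c, τ_c)` solves the cutoff system
`τ = 1 + r/(1+αr)`, `1+αr = (1+rτ)^α`. -/
theorem stmt_8 (α : ℝ) (hα : α < 0) (hα1 : α ≠ -1) :
    ∃ r_c : ℝ, 0 < r_c ∧ r_c < -1 / α ∧
      (1 + α * r_c) ^ (1 / α) = 1 + r_c + r_c ^ 2 / (1 + α * r_c) ∧
      (∀ r : ℝ, 0 < r → r < -1 / α →
        (1 + α * r) ^ (1 / α) = 1 + r + r ^ 2 / (1 + α * r) → r = r_c) ∧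
      1 / (1 - α) ≤ r_c ∧
      2 ≤ 1 + r_c / (1 + α * r_c) ∧
      1 + α * r_c = (1 + r_c * (1 + r_c / (1 + α * r_c))) ^ α := by
  have ha := hα.ne
  have ha1 : 1 + α ≠ 0 := fun h => hα1 (by linarith)
  have hU : ∀ r, r < -1 / α → 0 < 1 + α * r := by
    intro r hr
    rw [lt_div_iff_of_neg hα] at hr
    linarith
  have h1a : 0 < 1 - α := by linarith
  set s := 1 / (1 - α) with hs
  have hs0 : 0 < s := by positivity
  have hsα : (1 - α) * s = 1 := by rw [hs]; field_simp
  have hsR : s < -1 / α := by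
    rw [lt_div_iff_of_neg hα]; linarith
  have hmono : StrictMonoOn (auxH α) (Icc 0 s) := by
    apply strictMonoOn_of_deriv_pos (convex_Icc _ _)
    · intro x hx
      exact (aux_deriv α x ha ha1 hx.1
        (hU x (hx.2.trans_lt hsR))).continuousAt.continuousWithinAt
    · intro x hx
      rw [interior_Icc] at hx
      have hu := hU x (hx.2.trans hsR)
      rw [(aux_deriv α x ha ha1 hx.1.le hu).deriv]
      have hN := aux_N α x hx.1.le hu
      have : 0 < 1 - (1 - α) * x := by nlinarith [mul_lt_mul_of_pos_left hx.2 h1a]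
      have := hx.1
      positivity
  have hanti : StrictAntiOn (auxH α) (Ico s (-1 / α)) := by
    apply strictAntiOn_of_deriv_neg (convex_Ico _ _)
    · intro x hx
      exact (aux_deriv α x ha ha1 (hs0.le.trans hx.1)
        (hU x hx.2)).continuousAt.continuousWithinAt
    · intro x hx
      rw [interior_Ico] at hx
      have hx0 := hs0.trans hx.1
      have hu := hU x hx.2
      rw [(aux_deriv α x ha ha1 hx0.le hu).deriv]
      have hN := aux_N α x hx0.le hu
      have : 1 - (1 - α) * x < 0 := by nlinarith [mul_lt_mul_of_pos_left hx.1 h1a]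
      exact div_neg_of_neg_of_pos (mul_neg_of_pos_of_neg hx0 this) (mul_pos hN hu)
  have hH0 : auxH α 0 = 0 := by simp [auxH]
  have hHs : 0 < auxH α s := by
    rw [← hH0]; exact hmono ⟨le_rfl, hs0.le⟩ ⟨hs0.le, le_rfl⟩ hs0
  have hlim : Tendsto (auxH α) (𝓝[<] (-1 / α)) atBot := by
    have t1 : Tendsto (fun r : ℝ => log (1 + (1 + α) * r + (1 + α) * r ^ 2) / (1 + α))
        (𝓝[<] (-1 / α))
        (𝓝 (log (1 + (1 + α) * (-1 / α) + (1 + α) * (-1 / α) ^ 2) / (1 + α))) := by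
      have hne : 1 + (1 + α) * (-1 / α) + (1 + α) * (-1 / α) ^ 2 ≠ 0 := by
        have : 1 + (1 + α) * (-1 / α) + (1 + α) * (-1 / α) ^ 2 = (1 / α) ^ 2 := by
          field_simp; ring
        rw [this]; positivity
      have hc : ContinuousAt (fun r : ℝ => 1 + (1 + α) * r + (1 + α) * r ^ 2) (-1 / α) := by
        fun_prop
      exact ((hc.log hne).div_const _).tendsto.mono_left nhdsWithin_le_nhds
    have t2 : Tendsto (fun r : ℝ => log (1 + α * r)) (𝓝[<] (-1 / α)) atBot := by
      apply Real.tendsto_log_nhdsGT_zero.comp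
      apply tendsto_nhdsWithin_of_tendsto_nhds_of_eventually_within
      · have hc : ContinuousAt (fun r : ℝ => 1 + α * r) (-1 / α) := by fun_prop
        have := hc.tendsto
        have e : 1 + α * (-1 / α) = 0 := by field_simp; ring
        rw [e] at this
        exact this.mono_left nhdsWithin_le_nhds
      · filter_upwards [self_mem_nhdsWithin] with r hr using hU r hr
    have t3 := t1.add_atBot (t2.const_mul_atBot (r := -1 / α) (div_pos_of_neg_of_neg (by norm_num) hα))
    refine t3.congr fun r => ?_
    rw [auxH]; ring
  obtain ⟨b, hbneg, hsb, hbR⟩ : ∃ b, auxH α b < 0 ∧ s < b ∧ b < -1 / α := by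
    have e1 := hlim.eventually (eventually_lt_atBot 0)
    have e2 : ∀ᶠ r in 𝓝[<] (-1 / α), s < r := nhdsWithin_le_nhds (lt_mem_nhds hsR)
    have e3 : ∀ᶠ r in 𝓝[<] (-1 / α), r < -1 / α := self_mem_nhdsWithin
    exact (e1.and (e2.and e3)).exists
  have hcont : ContinuousOn (auxH α) (Icc s b) := fun x hx =>
    (aux_deriv α x ha ha1 (hs0.le.trans hx.1)
      (hU x (hx.2.trans_lt hbR))).continuousAt.continuousWithinAt
  obtain ⟨c, hc, hc0⟩ := intermediate_value_Icc' hsb.le hcont ⟨hbneg.le, hHs.le⟩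
  have hcpos : 0 < c := hs0.trans_le hc.1
  have hcR : c < -1 / α := hc.2.trans_lt hbR
  have hu := hU c hcR
  have heq := (aux_iff α c ha ha1 hcpos.le hu).2 hc0
  refine ⟨c, hcpos, hcR, heq, ?_, hc.1, ?_, ?_⟩
  · intro r hr hrR h
    have h0 := (aux_iff α r ha ha1 hr.le (hU r hrR)).1 h
    have hsr : s ≤ r := by
      by_contra! hlt
      have := hmono ⟨le_rfl, hs0.le⟩ ⟨hr.le, hlt.le⟩ hr
      linarith
    exact hanti.injOn ⟨hsr, hrR⟩ ⟨hc.1, hcR⟩ (h0.trans hc0.symm)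
  · have : 1 ≤ c / (1 + α * c) := by
      rw [le_div_iff₀ hu]
      nlinarith [mul_le_mul_of_nonneg_left hc.1 h1a.le]
    linarith
  · have : 1 + c * (1 + c / (1 + α * c)) = (1 + α * c) ^ (1 / α) := by
      rw [heq]; ring
    rw [this, ← rpow_mul hu.le, one_div_mul_cancel ha, rpow_one]
end

section
/- There exists a unique r_c > 0 satisfying r_c = ln(1 + r_c + r_c²). Moreover r_c ≥ 1, so τ_c := 1 + r_c satisfies τ_c ≥ 2. -/
lemma aux_pos (x : ℝ) : 0 < 1 + x + x ^ 2 := by nlinarith [sq_nonneg (x + 1 / 2)]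

lemma aux_deriv_s9 (x : ℝ) : HasDerivAt (fun r : ℝ => r - Real.log (1 + r + r ^ 2))
    ((x ^ 2 - x) / (1 + x + x ^ 2)) x := by
  have hp := aux_pos x
  have h1 : HasDerivAt (fun r : ℝ => 1 + r + r ^ 2) (1 + 2 * x) x := by
    refine HasDerivAt.congr_deriv (f := fun r : ℝ => 1 + r + r ^ 2)
      (((hasDerivAt_id' x).const_add 1).add (hasDerivAt_pow 2 x)) ?_
    simp
  refine HasDerivAt.congr_deriv (f := fun r : ℝ => r - Real.log (1 + r + r ^ 2))
    ((hasDerivAt_id' x).sub (h1.log hp.ne')) ?_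
  field_simp
  ring

lemma aux_cont : Continuous (fun r : ℝ => r - Real.log (1 + r + r ^ 2)) :=
  continuous_iff_continuousAt.2 fun x => (aux_deriv_s9 x).continuousAt

/-- There is a unique `r_c > 0` with `r_c = ln(1 + r_c + r_c²)`;
moreover `r_c ≥ 1`, so `τ_c := 1 + r_c` satisfies `τ_c ≥ 2`. -/
theorem stmt_9 :
    ∃ r_c : ℝ, 0 < r_c ∧ r_c = Real.log (1 + r_c + r_c ^ 2) ∧
      (∀ r : ℝ, 0 < r → r = Real.log (1 + r + r ^ 2) → r = r_c) ∧
      1 ≤ r_c ∧ 2 ≤ 1 + r_c := by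
  have hanti : StrictAntiOn (fun r : ℝ => r - Real.log (1 + r + r ^ 2)) (Set.Icc 0 1) := by
    apply strictAntiOn_of_deriv_neg (convex_Icc 0 1) aux_cont.continuousOn
    intro x hx
    rw [interior_Icc] at hx
    rw [(aux_deriv_s9 x).deriv]
    exact div_neg_of_neg_of_pos (by nlinarith [hx.1, hx.2]) (aux_pos x)
  have hmono : StrictMonoOn (fun r : ℝ => r - Real.log (1 + r + r ^ 2)) (Set.Ici 1) := by
    apply strictMonoOn_of_deriv_pos (convex_Ici 1) aux_cont.continuousOn
    intro x hx
    rw [interior_Ici] at hx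
    have hx' : 1 < x := hx
    rw [(aux_deriv_s9 x).deriv]
    exact div_pos (by nlinarith) (aux_pos x)
  have hneg : ∀ r : ℝ, 0 < r → r ≤ 1 → r - Real.log (1 + r + r ^ 2) < 0 := by
    intro r h0 h1
    have := hanti (show (0 : ℝ) ∈ Set.Icc 0 1 by simp) ⟨h0.le, h1⟩ h0
    simpa using this
  have h3 : 0 ≤ (3 : ℝ) - Real.log (1 + 3 + 3 ^ 2) := by
    have : Real.log (1 + 3 + 3 ^ 2) ≤ 3 := by
      rw [Real.log_le_iff_le_exp (by norm_num)]
      have h := Real.exp_one_gt_d9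
      have e : Real.exp 3 = Real.exp 1 ^ 3 := by rw [← Real.exp_nat_mul]; norm_num
      rw [e]
      have : (2.7 : ℝ) ^ 3 ≤ Real.exp 1 ^ 3 := by gcongr; linarith
      norm_num at this ⊢
      linarith
    linarith
  obtain ⟨c, hc, hc0⟩ := intermediate_value_Icc (show (1 : ℝ) ≤ 3 by norm_num)
    aux_cont.continuousOn ⟨(hneg 1 one_pos le_rfl).le, h3⟩
  have hc1 : 1 ≤ c := hc.1
  simp only at hc0
  refine ⟨c, by linarith, by linarith, ?_, hc1, by linarith⟩
  intro r hr he
  have hr1 : 1 ≤ r := by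
    by_contra! h
    have := hneg r hr h.le
    linarith
  apply hmono.injOn hr1 hc1
  simp only
  linarith
end

section
/- Let L(ζ) = −1/(2ζ²) on (0,∞) (the power fitness function y^α/α with α = −2). Then for τ, ξ, y > 0 one has Sw(τ,ξ,y) = 0 if and only if τ > 2 and y·(τ−2) = ξ·τ; equivalently, the mass ratio q := y/ξ satisfies q = τ/(τ−2). -/
/-- For the power fitness function `L(ζ) = −1/(2ζ²)` (i.e. `y^α/α` with
`α = −2`) and `τ, ξ, y > 0`: `Sw(τ,ξ,y) = 0` iff `τ > 2` and `y(τ−2) = ξτ`;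
equivalently the mass ratio `q = y/ξ` satisfies `q = τ/(τ−2)`. -/
theorem stmt_11 (τ ξ y : ℝ) (hτ : 0 < τ) (hξ : 0 < ξ) (hy : 0 < y) :
    (Sw (fun ζ : ℝ => -1 / (2 * ζ ^ 2)) τ ξ y = 0 ↔ 2 < τ ∧ y * (τ - 2) = ξ * τ) ∧
    (Sw (fun ζ : ℝ => -1 / (2 * ζ ^ 2)) τ ξ y = 0 ↔ 2 < τ ∧ y / ξ = τ / (τ - 2)) := by
  have hz : 0 < y + ξ * τ := by positivity
  have hpos : ∀ x ∈ Set.uIcc y (y + ξ * τ), 0 < x := by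
    intro x hx
    rw [Set.uIcc_of_le (by nlinarith [mul_pos hξ hτ])] at hx
    exact lt_of_lt_of_le hy hx.1
  have hd : ∀ x : ℝ, 0 < x →
      HasDerivAt (fun ζ : ℝ => -1 / (2 * ζ ^ 2)) (1 / x ^ 3) x := by
    intro x hx
    have h := (hasDerivAt_const x (-1 : ℝ)).fun_div (((hasDerivAt_id' x).fun_pow 2).const_mul 2)
      (by positivity)
    refine h.congr_deriv ?_
    field_simp
    norm_num
  have hint : (∫ ζ in y..(y + ξ * τ), ζ * deriv (fun ζ : ℝ => -1 / (2 * ζ ^ 2)) ζ)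
      = -(y + ξ * τ)⁻¹ - -y⁻¹ := by
    have hc : (∫ ζ in y..(y + ξ * τ), ζ * deriv (fun ζ : ℝ => -1 / (2 * ζ ^ 2)) ζ)
        = ∫ ζ in y..(y + ξ * τ), (ζ ^ 2)⁻¹ := by
      apply intervalIntegral.integral_congr
      intro x hx
      have hx0 := hpos x hx
      simp only [(hd x hx0).deriv]
      field_simp
    rw [hc]
    apply intervalIntegral.integral_eq_sub_of_hasDerivAt (f := fun x : ℝ => -x⁻¹)
    · intro x hx
      have h := (hasDerivAt_inv (hpos x hx).ne').fun_neg
      simpa using h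
    · apply ContinuousOn.intervalIntegrable
      apply ContinuousOn.inv₀ (by fun_prop)
      intro x hx
      exact pow_ne_zero _ (hpos x hx).ne'
  have hS : Sw (fun ζ : ℝ => -1 / (2 * ζ ^ 2)) τ ξ y
      = ξ ^ 2 * τ / (2 * y ^ 2 * (y + ξ * τ) ^ 2) * (y * (τ - 2) - ξ * τ) := by
    unfold Sw
    rw [hint]
    field_simp
    ring
  have h1 : Sw (fun ζ : ℝ => -1 / (2 * ζ ^ 2)) τ ξ y = 0 ↔
      2 < τ ∧ y * (τ - 2) = ξ * τ := by
    have hne : ξ ^ 2 * τ / (2 * y ^ 2 * (y + ξ * τ) ^ 2) ≠ 0 := by positivity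
    rw [hS, mul_eq_zero, or_iff_right hne, sub_eq_zero]
    constructor
    · intro h
      refine ⟨?_, h⟩
      have h2 : 0 < y * (τ - 2) := by rw [h]; positivity
      linarith [pos_of_mul_pos_right h2 hy.le]
    · exact fun h => h.2
  refine ⟨h1, h1.trans (and_congr_right fun h2 => ?_)⟩
  rw [div_eq_div_iff hξ.ne' (by linarith), mul_comm ξ τ]
end

section
/- Let α be a real number with α ≠ 0 and α ≠ −1, and let L(ζ) = ζ^α/α on (0,∞). Then for τ, ξ, y > 0, writing r := ξ/y: (i) Sw(τ,ξ,y) = 0 if and only if α·τ = (1 + α + 1/r)·(1 − (1+rτ)^{−α}); and (ii) Cut(τ,ξ,y) = 0 if and only if α·r = (1+rτ)^α − 1 (this equivalence holds also for α = −1). -/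
/-- For the power fitness function `L(ζ) = ζ^α/α` (`α ≠ 0`), `τ, ξ, y > 0`
and `r := ξ/y`: (i) if also `α ≠ −1` then `Sw(τ,ξ,y) = 0` iff
`α·τ = (1 + α + 1/r)(1 − (1+rτ)^{−α})`; and (ii) `Cut(τ,ξ,y) = 0` iff
`α·r = (1+rτ)^α − 1` (this equivalence holding also for `α = −1`). -/
theorem stmt_12 (α : ℝ) (hα0 : α ≠ 0) (τ ξ y : ℝ)
    (hτ : 0 < τ) (hξ : 0 < ξ) (hy : 0 < y) :
    (α ≠ -1 →
      (Sw (fun ζ : ℝ => ζ ^ α / α) τ ξ y = 0 ↔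
        α * τ = (1 + α + 1 / (ξ / y)) * (1 - (1 + (ξ / y) * τ) ^ (-α)))) ∧
    (Cut (fun ζ : ℝ => ζ ^ α / α) τ ξ y = 0 ↔
      α * (ξ / y) = (1 + (ξ / y) * τ) ^ α - 1) := by
  have hd : ∀ ζ : ℝ, 0 < ζ → deriv (fun ζ : ℝ => ζ ^ α / α) ζ = ζ ^ α / ζ := by
    intro ζ hζ
    have h := (Real.hasDerivAt_rpow_const (p := α) (Or.inl hζ.ne')).div_const α
    rw [h.deriv, Real.rpow_sub_one hζ.ne']
    field_simp
  obtain ⟨r, hr⟩ : ∃ r, r = ξ / y := ⟨_, rfl⟩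
  have hr0 : 0 < r := hr ▸ div_pos hξ hy
  have hξr : ξ = r * y := by rw [hr]; field_simp
  have hu : 0 < 1 + r * τ := by positivity
  have hz : y + ξ * τ = y * (1 + r * τ) := by rw [hξr]; ring
  have hzp : 0 < y + ξ * τ := by positivity
  have hzα : (y + ξ * τ) ^ α = y ^ α * (1 + r * τ) ^ α := by
    rw [hz, Real.mul_rpow hy.le hu.le]
  have hQ : 0 < y ^ α := Real.rpow_pos_of_pos hy α
  have hP : 0 < (1 + r * τ) ^ α := Real.rpow_pos_of_pos hu α
  rw [← hr]
  constructor
  · intro hα1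
    have hα1' : α + 1 ≠ 0 := fun h => hα1 (by linarith)
    have hint : (∫ ζ in y..(y + ξ * τ), ζ * deriv (fun ζ : ℝ => ζ ^ α / α) ζ)
        = ((y + ξ * τ) ^ (α + 1) - y ^ (α + 1)) / (α + 1) := by
      have hle : y ≤ y + ξ * τ := by
        have : 0 < ξ * τ := by positivity
        linarith
      rw [← integral_rpow (Or.inr ⟨hα1, by
        rw [Set.uIcc_of_le hle]; intro h; exact absurd h.1 (not_le.mpr hy)⟩)]
      apply intervalIntegral.integral_congr
      intro ζ hζ
      rw [Set.uIcc_of_le hle] at hζ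
      have hζ0 : 0 < ζ := lt_of_lt_of_le hy hζ.1
      simp only [hd ζ hζ0]
      field_simp
    unfold Sw
    rw [hint, Real.rpow_add_one hzp.ne', Real.rpow_add_one hy.ne', Real.rpow_neg hu.le]
    simp only [hzα]
    rw [hξr]
    generalize (1 + r * τ) ^ α = P at *
    generalize y ^ α = Q at *
    have key : (Q * P * (y + r * y * τ) - Q * y) / (α + 1) - (r * y + y) * (Q * P / α - Q / α)
        = (Q * y * r * P / (α * (α + 1))) * (α * τ - (1 + α + 1 / r) * (1 - P⁻¹)) := by
      field_simp
      ring
    rw [key, mul_eq_zero, sub_eq_zero]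
    have : Q * y * r * P / (α * (α + 1)) ≠ 0 := by positivity
    simp [this]
  · unfold Cut
    rw [hd y hy]
    simp only [hzα]
    rw [hξr]
    generalize (1 + r * τ) ^ α = P at *
    generalize y ^ α = Q at *
    have key : Q * P / α - Q / α - r * y * (Q / y) = (-Q / α) * (α * r - (P - 1)) := by
      field_simp
      ring
    rw [key, mul_eq_zero, sub_eq_zero]
    have : -Q / α ≠ 0 := div_ne_zero (neg_ne_zero.mpr hQ.ne') hα0
    simp only [this, false_or]
end

section
/- Let α < 1 with α ≠ 0 and α ≠ −1, and let (r_c, τ_c) be the unique solution of the cutoff system for α with r_c, τ_c > 0 and 1+αr_c > 0. Suppose r, τ > 0 satisfy 1+αr > 0, the switching-curve equation α·τ = (1 + α + 1/r)·(1 − (1+rτ)^{−α}), and the inequality r ≤ ((1+rτ)^α − 1)/α. Then r ≤ r_c and τ ≤ τ_c. -/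
lemma crossing (α : ℝ) (hα1 : α < 1) (hα0 : α ≠ 0) (hαm1 : α ≠ -1) (H : ℝ → ℝ)
    (hH : H = fun x => (1+α)*((1+α)*x^α + x^(-α) - (2+α) - α^2*(x-1)))
    (c x : ℝ) (hc : 1 < c) (hHc : H c = 0) (hHx : 0 ≤ H x) : x ≤ c := by
  by_contra! hcx
  set H1 : ℝ → ℝ := fun x => (1+α)*((1+α)*(α*x^(α-1)) + (-α)*x^(-α-1) - α^2) with hH1
  have d1 : ∀ y : ℝ, 0 < y → HasDerivAt H (H1 y) y := by
    intro y hy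
    have a1 := Real.hasDerivAt_rpow_const (x := y) (p := α) (Or.inl hy.ne')
    have a2 := Real.hasDerivAt_rpow_const (x := y) (p := -α) (Or.inl hy.ne')
    have := ((((a1.const_mul (1+α)).add a2).sub_const (2+α)).sub
      (((hasDerivAt_id y).sub_const 1).const_mul (α^2))).const_mul (1+α)
    rw [hH]
    refine this.congr_deriv ?_
    simp only [hH1]; ring
  set P : ℝ → ℝ := fun y => α * (1 - (1-α)*y^(2*α)) with hP
  have d2 : ∀ y : ℝ, 0 < y → HasDerivAt H1 ((1+α)^2 * y^(-α-2) * P y) y := by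
    intro y hy
    have a1 := Real.hasDerivAt_rpow_const (x := y) (p := α-1) (Or.inl hy.ne')
    have a2 := Real.hasDerivAt_rpow_const (x := y) (p := -α-1) (Or.inl hy.ne')
    have := ((((a1.const_mul α).const_mul (1+α)).add (a2.const_mul (-α))).sub_const (α^2)).const_mul (1+α)
    refine this.congr_deriv ?_
    have e1 : y^(α-1-1) = y^(-α-2) * y^(2*α) := by
      rw [← Real.rpow_add hy]; congr 1; ring
    have e2 : y^(-α-1-1) = y^(-α-2) := by congr 1; ring
    rw [e1, e2]; simp only [hP]; ring
  have Panti : ∀ y z : ℝ, 0 < y → y < z → P z < P y := by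
    intro y z hy hyz
    simp only [hP]
    rcases lt_or_gt_of_ne hα0 with h | h
    · have := Real.rpow_lt_rpow_of_neg hy hyz (by linarith : 2*α < 0)
      have h2 : 0 < -α*(1-α) := mul_pos (by linarith) (by linarith)
      nlinarith
    · have := Real.rpow_lt_rpow hy.le hyz (by linarith : 0 < 2*α)
      have h2 : 0 < α*(1-α) := mul_pos (by linarith) (by linarith)
      nlinarith
  set x0 : ℝ := (1-α)^(-(1/(2*α))) with hx0
  have h1a : 0 < 1 - α := by linarith
  have x0pos : 0 < x0 := Real.rpow_pos_of_pos h1a _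
  have Px0 : P x0 = 0 := by
    simp only [hP, hx0]
    rw [← Real.rpow_mul h1a.le]
    have : -(1/(2*α)) * (2*α) = -1 := by field_simp
    rw [this, Real.rpow_neg_one]; field_simp; simp
  have P1 : 0 < P 1 := by
    simp only [hP, Real.one_rpow]
    have : 0 < α^2 := by positivity
    nlinarith
  have hx01 : 1 < x0 := by
    by_contra! h
    rcases h.lt_or_eq with h | h
    · have := Panti x0 1 x0pos h; linarith
    · rw [h] at Px0; linarith
  have hpos : ∀ y : ℝ, 0 < y → 0 < (1+α)^2 * y^(-α-2) := by
    intro y hy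
    have : 1 + α ≠ 0 := fun h => hαm1 (by linarith)
    have := Real.rpow_pos_of_pos hy (-α-2)
    positivity
  have m1 : StrictMonoOn H1 (Set.Icc 1 x0) := by
    apply strictMonoOn_of_deriv_pos (convex_Icc _ _)
    · intro y hy
      exact (d2 y (by linarith [hy.1])).continuousAt.continuousWithinAt
    · intro y hy
      rw [interior_Icc] at hy
      have hy0 : 0 < y := by linarith [hy.1]
      rw [(d2 y hy0).deriv]
      have := Panti y x0 hy0 hy.2
      exact mul_pos (hpos y hy0) (by linarith)
  have H11 : H1 1 = 0 := by simp only [hH1, Real.one_rpow]; ring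
  have m0 : StrictMonoOn H (Set.Icc 1 x0) := by
    apply strictMonoOn_of_deriv_pos (convex_Icc _ _)
    · intro y hy
      exact (d1 y (by linarith [hy.1])).continuousAt.continuousWithinAt
    · intro y hy
      rw [interior_Icc] at hy
      have hy0 : 0 < y := by linarith [hy.1]
      rw [(d1 y hy0).deriv, ← H11]
      exact m1 ⟨le_rfl, hx01.le⟩ ⟨hy.1.le, hy.2.le⟩ hy.1
  have H01 : H 1 = 0 := by rw [hH]; simp only [Real.one_rpow]; ring
  have hx0c : x0 < c := by
    by_contra! h
    have := m0 ⟨le_rfl, hx01.le⟩ ⟨hc.le, h⟩ hc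
    linarith
  have Hx0 : 0 < H x0 := by
    rw [← H01]; exact m0 ⟨le_rfl, hx01.le⟩ ⟨hx01.le, le_rfl⟩ hx01
  have conc : ConcaveOn ℝ (Set.Ici x0) H := by
    apply AntitoneOn.concaveOn_of_deriv (convex_Ici _)
    · intro y hy
      exact (d1 y (lt_of_lt_of_le x0pos hy)).continuousAt.continuousWithinAt
    · intro y hy
      rw [interior_Ici] at hy
      exact (d1 y (lt_trans x0pos hy)).differentiableAt.differentiableWithinAt
    · rw [interior_Ici]
      have : AntitoneOn H1 (Set.Ioi x0) := by
        apply antitoneOn_of_deriv_nonpos (convex_Ioi _)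
        · intro y hy
          exact (d2 y (lt_trans x0pos hy)).continuousAt.continuousWithinAt
        · intro y hy
          rw [interior_Ioi] at hy
          exact (d2 y (lt_trans x0pos hy)).differentiableAt.differentiableWithinAt
        · intro y hy
          rw [interior_Ioi] at hy
          have hy0 : 0 < y := lt_trans x0pos hy
          rw [(d2 y hy0).deriv]
          have := Panti x0 y x0pos hy
          exact mul_nonpos_of_nonneg_of_nonpos (hpos y hy0).le (by linarith)
      refine this.congr ?_
      intro y hy
      exact (d1 y (lt_trans x0pos hy)).deriv.symm
  have sl := conc.slope_anti_adjacent (x := x0) (y := c) (z := x) (Set.self_mem_Ici)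
    (by show x0 ≤ x; linarith) hx0c hcx
  rw [hHc] at sl
  have s1 : 0 ≤ (H x - 0)/(x - c) := div_nonneg (by linarith) (by linarith)
  have s2 : (0 - H x0)/(c - x0) < 0 := div_neg_of_neg_of_pos (by linarith) (by linarith)
  linarith

lemma m_deriv (α : ℝ) (hα0 : α ≠ 0) (y : ℝ) (hy : 0 < y) :
    HasDerivAt (fun x : ℝ => (1 - x^(-α))/α) (y^(-α-1)) y := by
  have a2 := Real.hasDerivAt_rpow_const (x := y) (p := -α) (Or.inl hy.ne')
  refine ((a2.const_sub 1).div_const α).congr_deriv ?_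
  field_simp

lemma r_mono (α : ℝ) (hα0 : α ≠ 0) (x c : ℝ) (hx : 1 < x) (hxc : x ≤ c) :
    0 ≤ (1+α) * ((1 - x^(-α))/α * (c-1) - (x-1) * ((1 - c^(-α))/α)) := by
  have conc : ConcaveOn ℝ (Set.Ici 1) (fun x : ℝ => (1+α)*((1 - x^(-α))/α)) := by
    have d : ∀ y : ℝ, 0 < y → HasDerivAt (fun x : ℝ => (1+α)*((1 - x^(-α))/α)) ((1+α)*y^(-α-1)) y :=
      fun y hy => (m_deriv α hα0 y hy).const_mul (1+α)
    apply AntitoneOn.concaveOn_of_deriv (convex_Ici _)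
    · intro y hy
      exact (d y (lt_of_lt_of_le one_pos hy)).continuousAt.continuousWithinAt
    · intro y hy
      rw [interior_Ici] at hy
      exact (d y (lt_trans one_pos hy)).differentiableAt.differentiableWithinAt
    · rw [interior_Ici]
      intro y hy z hz hyz
      have hy0 : (0:ℝ) < y := lt_trans one_pos hy
      rw [(d y hy0).deriv, (d z (lt_trans one_pos hz)).deriv]
      rcases le_total 0 (1+α) with h | h
      · exact mul_le_mul_of_nonneg_left (Real.rpow_le_rpow_of_nonpos hy0 hyz (by linarith)) h
      · exact mul_le_mul_of_nonpos_left (Real.rpow_le_rpow hy0.le hyz (by linarith)) h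
  rcases hxc.lt_or_eq with h | h
  · have sl := conc.slope_anti_adjacent (x := 1) (y := x) (z := c) (Set.self_mem_Ici)
      (by show 1 ≤ c; linarith) hx h
    rw [div_le_div_iff₀ (by linarith) (by linarith)] at sl
    simp only [Real.one_rpow, sub_self, zero_div, mul_zero] at sl
    linarith
  · subst h; apply le_of_eq; ring

lemma sinh_cmp (α : ℝ) (hα1 : α < 1) (hα0 : α ≠ 0) (s : ℝ) (hs : 0 ≤ s) :
    (1+α) * (Real.sinh (α*s)/α - Real.sinh s) ≤ 0 := by
  have d : ∀ y : ℝ, HasDerivAt (fun s => (1+α) * (Real.sinh (α*s)/α - Real.sinh s))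
      ((1+α) * (Real.cosh (α*y) - Real.cosh y)) y := by
    intro y
    have a := ((hasDerivAt_id y).const_mul α).sinh
    refine (((a.div_const α).sub (Real.hasDerivAt_sinh y)).const_mul (1+α)).congr_deriv ?_
    simp only [id, mul_one]; rw [mul_div_assoc, div_self hα0, mul_one]
  have anti : AntitoneOn (fun s => (1+α) * (Real.sinh (α*s)/α - Real.sinh s)) (Set.Ici 0) := by
    apply antitoneOn_of_deriv_nonpos (convex_Ici _)
    · intro y hy; exact (d y).continuousAt.continuousWithinAt
    · intro y hy; exact (d y).differentiableAt.differentiableWithinAt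
    · intro y hy
      rw [interior_Ici] at hy
      have hy : 0 < y := hy
      rw [(d y).deriv]
      rcases le_total 0 (1+α) with h | h
      · have : Real.cosh (α*y) ≤ Real.cosh y := by
          rw [Real.cosh_le_cosh, abs_mul]
          have : |α| ≤ 1 := abs_le.2 ⟨by linarith, hα1.le⟩
          nlinarith [abs_nonneg y]
        exact mul_nonpos_of_nonneg_of_nonpos h (by linarith)
      · have : Real.cosh y ≤ Real.cosh (α*y) := by
          rw [Real.cosh_le_cosh, abs_mul]
          have : 1 ≤ |α| := by rw [abs_of_neg (by linarith)]; linarith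
          nlinarith [abs_nonneg y]
        exact mul_nonpos_of_nonpos_of_nonneg h (by linarith)
  have := anti (Set.self_mem_Ici) (show (0:ℝ) ≤ s from hs) hs
  simpa using this

lemma m_pos (α : ℝ) (hα0 : α ≠ 0) (y : ℝ) (hy : 1 < y) : 0 < (1 - y^(-α))/α := by
  rcases lt_or_gt_of_ne hα0 with h | h
  · have := Real.one_lt_rpow hy (by linarith : 0 < -α)
    exact div_pos_of_neg_of_neg (by linarith) h
  · have := Real.rpow_lt_one_of_one_lt_of_neg hy (by linarith : -α < 0)
    exact div_pos (by linarith) h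

lemma t_key (α : ℝ) (hα1 : α < 1) (hα0 : α ≠ 0) (y : ℝ) (hy : 1 < y) :
    (1+α) * (((1 - y^(-α))/α)^2 - (y-1)^2 * y^(-α-1)) ≤ 0 := by
  have hm := m_pos α hα0 y hy
  have hy0 : 0 < y := by linarith
  obtain ⟨s, hs⟩ : ∃ s, s = Real.log y / 2 := ⟨_, rfl⟩
  have hsp : 0 < s := by rw [hs]; have := Real.log_pos hy; linarith
  have hys : y = Real.exp (2*s) := by rw [hs, mul_div_cancel₀ _ (by norm_num), Real.exp_log hy0]
  have key := sinh_cmp α hα1 hα0 s hsp.le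
  have e0 : ∀ p : ℝ, y^p = Real.exp (2*s*p) := by
    intro p; rw [hys, ← Real.exp_mul]
  have e1 : (1 - y^(-α))/α = Real.exp (-(α*s)) * 2 * (Real.sinh (α*s)/α) := by
    rw [e0, Real.sinh_eq, show 2*s*(-α) = -(α*s) + -(α*s) by ring, Real.exp_add]
    have : Real.exp (-(α*s)) * Real.exp (α*s) = 1 := by rw [← Real.exp_add]; simp
    field_simp
    linear_combination -this
  have e2 : (y-1)^2 * y^(-α-1) = (Real.exp (-(α*s)) * 2 * Real.sinh s)^2 := by
    have h1 : y - 1 = Real.exp s * 2 * Real.sinh s := by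
      have : Real.exp s * Real.exp (-s) = 1 := by rw [← Real.exp_add]; simp
      have h2 : Real.exp (2*s) = Real.exp s * Real.exp s := by rw [← Real.exp_add]; ring_nf
      rw [hys, Real.sinh_eq, h2]; linear_combination this
    have h3 : Real.exp s^2 * y^(-α-1) = Real.exp (-(α*s))^2 := by
      rw [e0, ← Real.exp_nat_mul, ← Real.exp_nat_mul, ← Real.exp_add]; congr 1; push_cast; ring
    rw [h1]; linear_combination 4 * Real.sinh s^2 * h3
  have p1 : 0 < Real.sinh (α*s)/α := by
    rw [e1] at hm
    have := Real.exp_pos (-(α*s))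
    exact (pos_iff_pos_of_mul_pos hm).1 (by positivity)
  have p2 : 0 < Real.sinh s := Real.sinh_pos_iff.2 hsp
  rw [e2, e1]
  have : (1+α) * ((Real.exp (-(α*s)) * 2 * (Real.sinh (α*s)/α))^2 - (Real.exp (-(α*s)) * 2 * Real.sinh s)^2)
    = (4 * Real.exp (-(α*s))^2 * (Real.sinh (α*s)/α + Real.sinh s)) * ((1+α) * (Real.sinh (α*s)/α - Real.sinh s)) := by ring
  rw [this]
  exact mul_nonpos_of_nonneg_of_nonpos (by positivity) key

lemma t_mono (α : ℝ) (hα1 : α < 1) (hα0 : α ≠ 0) :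
    AntitoneOn (fun x : ℝ => (1+α) * (((1 - x^(-α))/α)⁻¹ - (x-1)⁻¹)) (Set.Ioi 1) := by
  have d : ∀ y : ℝ, 1 < y → HasDerivAt (fun x : ℝ => (1+α) * (((1 - x^(-α))/α)⁻¹ - (x-1)⁻¹))
     ((1+α) * (-(y^(-α-1)) / ((1 - y^(-α))/α)^2 - (-1)/(y-1)^2)) y := by
    intro y hy
    have a := (m_deriv α hα0 y (by linarith)).fun_inv (m_pos α hα0 y hy).ne'
    have b := ((hasDerivAt_id y).sub_const 1).fun_inv (by simp; linarith)
    exact (a.sub b).const_mul (1+α)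
  apply antitoneOn_of_deriv_nonpos (convex_Ioi _)
  · intro y hy; exact (d y hy).continuousAt.continuousWithinAt
  · intro y hy
    rw [interior_Ioi] at hy
    exact (d y hy).differentiableAt.differentiableWithinAt
  · intro y hy
    rw [interior_Ioi] at hy
    have hy : 1 < y := hy
    rw [(d y hy).deriv]
    have hm := m_pos α hα0 y hy
    have key := t_key α hα1 hα0 y hy
    set m := (1 - y^(-α))/α
    have h1 : 0 < y - 1 := by linarith
    have : (1+α) * (-(y^(-α-1)) / m^2 - (-1)/(y-1)^2)
      = (1/(m^2*(y-1)^2)) * ((1+α) * (m^2 - (y-1)^2 * y^(-α-1))) := by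
      field_simp; ring
    rw [this]
    exact mul_nonpos_of_nonneg_of_nonpos (by positivity) key

/-- Let `α < 1`, `α ≠ 0`, `α ≠ −1`, and let `(r_c, τ_c)` be the (unique)
positive solution of the cutoff system `τ = 1 + r/(1+αr)`, `1+αr = (1+rτ)^α` with
`1+αr_c > 0`. If `r, τ > 0` satisfy `1+αr > 0`, the switching-curve equation
`α·τ = (1 + α + 1/r)(1 − (1+rτ)^{−α})`, and `r ≤ ((1+rτ)^α − 1)/α`, then
`r ≤ r_c` and `τ ≤ τ_c`. -/
theorem stmt_13 (α : ℝ) (hα1 : α < 1) (hα0 : α ≠ 0) (hαm1 : α ≠ -1)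
    (r_c τ_c : ℝ) (hrc : 0 < r_c) (hτc : 0 < τ_c) (hrc' : 0 < 1 + α * r_c)
    (hsys1 : τ_c = 1 + r_c / (1 + α * r_c))
    (hsys2 : 1 + α * r_c = (1 + r_c * τ_c) ^ α)
    (r τ : ℝ) (hr : 0 < r) (hτ : 0 < τ) (hr' : 0 < 1 + α * r)
    (hswitch : α * τ = (1 + α + 1 / r) * (1 - (1 + r * τ) ^ (-α)))
    (hineq : r ≤ ((1 + r * τ) ^ α - 1) / α) :
    r ≤ r_c ∧ τ ≤ τ_c := by
  have hx : 1 < 1 + r * τ := by have := mul_pos hr hτ; linarith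
  have hc : 1 < 1 + r_c * τ_c := by have := mul_pos hrc hτc; linarith
  have hβ : 1 + α ≠ 0 := fun h => hαm1 (by linarith)
  have hβ2 : 0 < (1 + α)^2 := by positivity
  obtain ⟨x, hxd⟩ : ∃ x, x = 1 + r * τ := ⟨_, rfl⟩
  obtain ⟨c, hcd⟩ : ∃ c, c = 1 + r_c * τ_c := ⟨_, rfl⟩
  rw [← hxd] at hx hswitch hineq
  rw [← hcd] at hc hsys2
  have hx0 : 0 < x := by linarith
  have hc0 : 0 < c := by linarith
  have hmx := m_pos α hα0 x hx
  have hmc := m_pos α hα0 c hc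
  have hux : 0 < x^α := Real.rpow_pos_of_pos hx0 _
  have ex : x^(-α) = (x^α)⁻¹ := Real.rpow_neg hx0.le _
  have ec : c^(-α) = (1 + α*r_c)⁻¹ := by rw [hsys2, Real.rpow_neg hc0.le]
  -- switching equations in terms of `m`
  have sx : x - 1 = ((1+α)*r+1) * ((1 - x^(-α))/α) := by
    have : x - 1 = r * (α * τ) / α := by rw [hxd]; field_simp; ring
    rw [this, hswitch]; field_simp
  have sc : c - 1 = ((1+α)*r_c+1) * ((1 - c^(-α))/α) := by
    have hne : 1 + α*r_c ≠ 0 := hrc'.ne'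
    rw [ec, hcd, hsys1]
    generalize hv : 1 + α*r_c = v at *
    field_simp
    rw [← hv]; ring
  have hxc : x ≤ c := by
    refine crossing α hα1 hα0 hαm1 _ rfl c x hc ?_ ?_
    · have h1 : α^2*(c-1) = α*(((1+α)*r_c+1)*(1 - c^(-α))) := by rw [sc]; field_simp
      show (1+α)*((1+α)*c^α + c^(-α) - (2+α) - α^2*(c-1)) = 0
      rw [h1, ec, ← hsys2]; field_simp; ring
    · have h1 : α^2*(x-1) = α*(((1+α)*r+1)*(1 - x^(-α))) := by rw [sx]; field_simp
      show 0 ≤ (1+α)*((1+α)*x^α + x^(-α) - (2+α) - α^2*(x-1))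
      rw [h1, ex]
      set u := x^α
      set l := (u-1)/α with hl
      have hul : u = 1 + α*l := by rw [hl]; field_simp; ring
      have e : (1+α)*((1+α)*u + u⁻¹ - (2+α) - α*(((1+α)*r+1)*(1 - u⁻¹)))
        = (1+α)^2 * (α^2 * (l - r) * l) / u := by
        have e' : α^2 * (l-r) * l = (u-1-α*r)*(u-1) := by rw [hul]; ring
        rw [e']; field_simp; ring
      rw [e]
      have : 0 ≤ l - r := by linarith
      have : 0 ≤ l := by linarith
      positivity
  constructor
  · have h := r_mono α hα0 x c hx hxc
    set m := (1 - x^(-α))/α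
    set n := (1 - c^(-α))/α
    rw [sx, sc] at h
    have h2 : 0 ≤ (1+α)^2 * (m*n) * (r_c - r) := by
      calc (0:ℝ) ≤ _ := h
        _ = _ := by ring
    have := nonneg_of_mul_nonneg_right h2 (by positivity)
    linarith
  · have h := t_mono α hα1 hα0 hx hc hxc
    simp only at h
    have tx : (1+α) * (((1 - x^(-α))/α)⁻¹ - (x-1)⁻¹) = (1+α)^2 * τ⁻¹ := by
      have h1 : r * τ = x - 1 := by rw [hxd]; ring
      have h2 : τ⁻¹ = r / (x-1) := by rw [← h1]; field_simp
      have h3 : x - 1 ≠ 0 := by linarith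
      rw [h2]
      set m := (1 - x^(-α))/α
      have : m⁻¹ = ((1+α)*r+1)/(x-1) := by
        rw [eq_div_iff h3, sx]; field_simp
      rw [this]; field_simp; ring
    have tc : (1+α) * (((1 - c^(-α))/α)⁻¹ - (c-1)⁻¹) = (1+α)^2 * τ_c⁻¹ := by
      have h1 : r_c * τ_c = c - 1 := by rw [hcd]; ring
      have h2 : τ_c⁻¹ = r_c / (c-1) := by rw [← h1]; field_simp
      have h3 : c - 1 ≠ 0 := by linarith
      rw [h2]
      set m := (1 - c^(-α))/α
      have : m⁻¹ = ((1+α)*r_c+1)/(c-1) := by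
        rw [eq_div_iff h3, sc]; field_simp
      rw [this]; field_simp; ring
    rw [tx, tc] at h
    exact (inv_le_inv₀ hτc hτ).1 (le_of_mul_le_mul_left h hβ2)
end

section
/- Let P, L : (0,∞) → ℝ be twice differentiable with P(x) > 0 and P'(x) > 0 for all x > 0. Let I be an open interval and x, y : I → (0,∞) be differentiable functions such that, for all t ∈ I, the denominator D(t) := L''(y(t)) + L'(y(t))·P''(x(t))/P'(x(t)) is nonzero, and setting u(t) := (L''(y(t)) + L'(y(t))·P'(x(t))/P(x(t)))/D(t), the equations x'(t) = u(t)·P(x(t)) and y'(t) = (1−u(t))·P(x(t)) hold. Then the function t ↦ L(y(t)) + (P(x(t))/P'(x(t)))·L'(y(t)) is constant on I. -/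
/-- Along any trajectory of the two-sector allocation system
`ẋ = uP(x)`, `ẏ = (1−u)P(x)` driven by the singular feedback control
`u = (L''(y)+L'(y)P'(x)/P(x)) / (L''(y)+L'(y)P''(x)/P'(x))`, the Hamiltonian
`H(x,y) = L(y) + (P(x)/P'(x))·L'(y)` is constant. -/
theorem stmt_14 (P L : ℝ → ℝ)
    (hPdiff : ∀ x : ℝ, 0 < x → DifferentiableAt ℝ P x)
    (hPdiff2 : ∀ x : ℝ, 0 < x → DifferentiableAt ℝ (deriv P) x)
    (hLdiff : ∀ z : ℝ, 0 < z → DifferentiableAt ℝ L z)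
    (hLdiff2 : ∀ z : ℝ, 0 < z → DifferentiableAt ℝ (deriv L) z)
    (hPpos : ∀ x : ℝ, 0 < x → 0 < P x)
    (hP'pos : ∀ x : ℝ, 0 < x → 0 < deriv P x)
    (a b : ℝ) (x y : ℝ → ℝ)
    (hx : ∀ t ∈ Set.Ioo a b, 0 < x t)
    (hy : ∀ t ∈ Set.Ioo a b, 0 < y t)
    (D : ℝ → ℝ)
    (hD : ∀ t ∈ Set.Ioo a b,
      D t = deriv (deriv L) (y t) + deriv L (y t) * deriv (deriv P) (x t) / deriv P (x t))
    (hDne : ∀ t ∈ Set.Ioo a b, D t ≠ 0)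
    (u : ℝ → ℝ)
    (hu : ∀ t ∈ Set.Ioo a b,
      u t = (deriv (deriv L) (y t) + deriv L (y t) * deriv P (x t) / P (x t)) / D t)
    (hx' : ∀ t ∈ Set.Ioo a b, HasDerivAt x (u t * P (x t)) t)
    (hy' : ∀ t ∈ Set.Ioo a b, HasDerivAt y ((1 - u t) * P (x t)) t) :
    ∀ s ∈ Set.Ioo a b, ∀ t ∈ Set.Ioo a b,
      L (y s) + P (x s) / deriv P (x s) * deriv L (y s) =
        L (y t) + P (x t) / deriv P (x t) * deriv L (y t) := by
  have key : ∀ t ∈ Set.Ioo a b,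
      HasDerivAt (fun t => L (y t) + P (x t) / deriv P (x t) * deriv L (y t)) 0 t := by
    intro t ht
    have hp := (hPpos _ (hx t ht)).ne'
    have hq := (hP'pos _ (hx t ht)).ne'
    have h1 := (hLdiff _ (hy t ht)).hasDerivAt.comp t (hy' t ht)
    have h2 := (hLdiff2 _ (hy t ht)).hasDerivAt.comp t (hy' t ht)
    have h3 := (hPdiff _ (hx t ht)).hasDerivAt.comp t (hx' t ht)
    have h4 := (hPdiff2 _ (hx t ht)).hasDerivAt.comp t (hx' t ht)
    have h5 := h1.add ((h3.div h4 hq).mul h2)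
    have hU : u t * (deriv (deriv L) (y t)
        + deriv L (y t) * deriv (deriv P) (x t) / deriv P (x t))
        = deriv (deriv L) (y t) + deriv L (y t) * deriv P (x t) / P (x t) := by
      rw [← hD t ht, hu t ht, div_mul_cancel₀ _ (hDne t ht)]
    refine HasDerivAt.congr_deriv h5 ?_
    simp only [Function.comp_apply, Pi.div_apply]
    generalize deriv (deriv L) (y t) = m at *
    generalize deriv (deriv P) (x t) = r at *
    generalize deriv L (y t) = l at *
    generalize deriv P (x t) = q at *
    generalize P (x t) = p at *
    generalize u t = v at *
    have e : l * ((1 - v) * p) + ((q * (v * p) * q - p * (r * (v * p))) / q ^ 2 * l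
        + p / q * (m * ((1 - v) * p)))
        = p ^ 2 / q * ((m + l * q / p) - v * (m + l * r / q)) := by
      field_simp
      ring
    rw [e, hU, sub_self, mul_zero]
  intro s hs t ht
  exact isOpen_Ioo.is_const_of_deriv_eq_zero isPreconnected_Ioo
    (fun t ht => (key t ht).differentiableAt.differentiableWithinAt)
    (fun t ht => (key t ht).deriv) hs ht
end

section
/- Let α be a real number with α ≠ 0 and α ≠ 1, let C ∈ ℝ, and let I be an interval on which exp((α/(1−α))·(C−t)) ≠ 1. Then the function q(t) := α/(exp((α/(1−α))·(C−t)) − 1) is differentiable on I and satisfies q'(t) = 1 − (1+q(t))·(1 − q(t)/(1−α)) for all t ∈ I. -/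
/-- For `α ≠ 0`, `α ≠ 1`, `C ∈ ℝ`, and an interval `I` on which
`exp((α/(1−α))(C−t)) ≠ 1`, the singular-arc mass ratio
`q(t) = α/(exp((α/(1−α))(C−t)) − 1)` is differentiable on `I` and satisfies
`q' = 1 − (1+q)(1 − q/(1−α))` there. -/
theorem stmt_15 (α : ℝ) (hα0 : α ≠ 0) (hα1 : α ≠ 1) (C : ℝ)
    (I : Set ℝ) (hI : I.OrdConnected)
    (hne : ∀ t ∈ I, Real.exp (α / (1 - α) * (C - t)) ≠ 1) :
    ∀ t ∈ I,
      HasDerivAt (fun s : ℝ => α / (Real.exp (α / (1 - α) * (C - s)) - 1))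
        (1 - (1 + α / (Real.exp (α / (1 - α) * (C - t)) - 1)) *
          (1 - (α / (Real.exp (α / (1 - α) * (C - t)) - 1)) / (1 - α))) t := by
  intro t ht
  have h1 : Real.exp (α / (1 - α) * (C - t)) - 1 ≠ 0 := sub_ne_zero.mpr (hne t ht)
  have h2 : (1 - α) ≠ 0 := sub_ne_zero.mpr (Ne.symm hα1)
  have h3 : HasDerivAt (fun s : ℝ => α / (1 - α) * (C - s)) (α / (1 - α) * (-1)) t :=
    ((hasDerivAt_id t).const_sub C).const_mul _
  have h4 := (hasDerivAt_const t α).fun_div (h3.exp.sub_const 1) h1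
  refine h4.congr_deriv ?_
  generalize Real.exp (α / (1 - α) * (C - t)) = E at h1 ⊢
  field_simp
  ring
end

section
/- Let P : (0,∞) → ℝ be continuously differentiable with P(x) > 0 and P'(x) > 0 for all x > 0, let L : (0,∞) → ℝ be continuously differentiable, let x₀, y₀ > 0, T > 0, δ ∈ (0,T), and let x : (−δ,δ) → (0,∞) be differentiable with x(0) = x₀ and x'(ε) = P(x(ε)) for all ε. Define J(ε) := ε·L(y₀) + ∫₀^{T−ε} L(y₀ + P(x(ε))·t) dt. Then J is differentiable at ε = 0 with J'(0) = (P'(x₀)/P(x₀))·Sw(P'(x₀)·T, P(x₀)/P'(x₀), y₀). Consequently, if Sw(P'(x₀)·T, P(x₀)/P'(x₀), y₀) > 0, then J(ε) > J(0) for all sufficiently small ε > 0. -/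
/-- perturbing a pure reproductive schedule by an initial vegetative
interval `[0,ε]` gives payoff `J(ε) = ε·L(y₀) + ∫₀^{T−ε} L(y₀ + P(x(ε))t) dt`, with
`J'(0) = (P'(x₀)/P(x₀))·Sw(P'(x₀)T, P(x₀)/P'(x₀), y₀)`; consequently if
`Sw(P'(x₀)T, P(x₀)/P'(x₀), y₀) > 0` then `J(ε) > J(0)` for all small `ε > 0`. -/
theorem stmt_16 (P L : ℝ → ℝ)
    (hPdiff : ∀ x : ℝ, 0 < x → DifferentiableAt ℝ P x)
    (hPcont : ContinuousOn (deriv P) (Set.Ioi 0))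
    (hPpos : ∀ x : ℝ, 0 < x → 0 < P x)
    (hP'pos : ∀ x : ℝ, 0 < x → 0 < deriv P x)
    (hLdiff : ∀ z : ℝ, 0 < z → DifferentiableAt ℝ L z)
    (hLcont : ContinuousOn (deriv L) (Set.Ioi 0))
    (x₀ y₀ T δ : ℝ) (hx₀ : 0 < x₀) (hy₀ : 0 < y₀) (hT : 0 < T)
    (hδ : 0 < δ) (hδT : δ < T)
    (x : ℝ → ℝ) (hx0 : x 0 = x₀)
    (hxpos : ∀ ε ∈ Set.Ioo (-δ) δ, 0 < x ε)
    (hx' : ∀ ε ∈ Set.Ioo (-δ) δ, HasDerivAt x (P (x ε)) ε) :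
    HasDerivAt (fun ε : ℝ => ε * L y₀ + ∫ t in (0 : ℝ)..(T - ε), L (y₀ + P (x ε) * t))
      (deriv P x₀ / P x₀ * Sw L (deriv P x₀ * T) (P x₀ / deriv P x₀) y₀) 0 ∧
    (0 < Sw L (deriv P x₀ * T) (P x₀ / deriv P x₀) y₀ →
      ∀ᶠ ε in nhdsWithin 0 (Set.Ioi 0),
        ((0 : ℝ) * L y₀ + ∫ t in (0 : ℝ)..(T - 0), L (y₀ + P (x 0) * t)) <
          ε * L y₀ + ∫ t in (0 : ℝ)..(T - ε), L (y₀ + P (x ε) * t)) := by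
  have h0 : (0:ℝ) ∈ Set.Ioo (-δ) δ := ⟨by linarith, hδ⟩
  have hp : 0 < P x₀ := hPpos x₀ hx₀
  have hp' : 0 < deriv P x₀ := hP'pos x₀ hx₀
  have hLc : ContinuousOn L (Set.Ioi 0) := fun z hz =>
    (hLdiff z hz).continuousAt.continuousWithinAt
  have hY : 0 < y₀ + P x₀ * T := by positivity
  have hsub : Set.uIcc y₀ (y₀ + P x₀ * T) ⊆ Set.Ioi 0 := by
    intro z hz
    exact lt_of_lt_of_le (lt_min hy₀ hY) hz.1
  have hLint : IntervalIntegrable L MeasureTheory.volume y₀ (y₀ + P x₀ * T) :=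
    (hLc.mono hsub).intervalIntegrable
  have hL'int : IntervalIntegrable (deriv L) MeasureTheory.volume y₀ (y₀ + P x₀ * T) :=
    (hLcont.mono hsub).intervalIntegrable
  have hparts : (∫ ζ in y₀..(y₀ + P x₀ * T), ζ * deriv L ζ)
      = (y₀ + P x₀ * T) * L (y₀ + P x₀ * T) - y₀ * L y₀
        - ∫ ζ in y₀..(y₀ + P x₀ * T), L ζ := by
    have := intervalIntegral.integral_mul_deriv_eq_deriv_mul
      (a := y₀) (b := y₀ + P x₀ * T) (u := fun z : ℝ => z) (u' := fun _ => (1:ℝ))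
      (v := L) (v' := deriv L)
      (fun z _ => hasDerivAt_id z) (fun z hz => (hLdiff z (hsub hz)).hasDerivAt)
      intervalIntegrable_const hL'int
    simpa using this
  have hmeas : StronglyMeasurableAtFilter L (nhds (y₀ + P x₀ * T)) MeasureTheory.volume :=
    hLc.stronglyMeasurableAtFilter isOpen_Ioi _ hY
  have hG : HasDerivAt (fun u => ∫ z in y₀..u, L z) (L (y₀ + P x₀ * T)) (y₀ + P x₀ * T) :=
    intervalIntegral.integral_hasDerivAt_right hLint hmeas (hLdiff _ hY).continuousAt
  have hx1 : HasDerivAt x (P x₀) 0 := by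
    have := hx' 0 h0
    rwa [hx0] at this
  have hPx : HasDerivAt (fun ε => P (x ε)) (deriv P x₀ * P x₀) 0 := by
    have h1 : HasDerivAt P (deriv P x₀) (x 0) := by
      rw [hx0]; exact (hPdiff x₀ hx₀).hasDerivAt
    exact h1.comp 0 hx1
  have hU : HasDerivAt (fun ε => y₀ + P (x ε) * (T - ε))
      (deriv P x₀ * P x₀ * T - P x₀) 0 := by
    have h2 := (hPx.mul ((hasDerivAt_id (0:ℝ)).const_sub T)).const_add y₀
    refine h2.congr_deriv ?_
    simp [hx0]; ring
  have hGU : HasDerivAt (fun ε => ∫ z in y₀..(y₀ + P (x ε) * (T - ε)), L z)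
      (L (y₀ + P x₀ * T) * (deriv P x₀ * P x₀ * T - P x₀)) 0 := by
    have hG' : HasDerivAt (fun u => ∫ z in y₀..u, L z) (L (y₀ + P x₀ * T))
      ((fun ε => y₀ + P (x ε) * (T - ε)) 0) := by
      simpa [hx0] using hG
    exact hG'.comp 0 hU
  have hmain : HasDerivAt
      (fun ε : ℝ => ε * L y₀ + ∫ t in (0 : ℝ)..(T - ε), L (y₀ + P (x ε) * t))
      (deriv P x₀ / P x₀ * Sw L (deriv P x₀ * T) (P x₀ / deriv P x₀) y₀) 0 := by
    have hne : P (x 0) ≠ 0 := by rw [hx0]; exact hp.ne'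
    have h3 := ((hasDerivAt_id (0:ℝ)).mul_const (L y₀)).add (hGU.div hPx hne)
    have hev : (fun ε : ℝ => ε * L y₀ + ∫ t in (0 : ℝ)..(T - ε), L (y₀ + P (x ε) * t))
        =ᶠ[nhds 0] (fun ε : ℝ => ε * L y₀ +
          (∫ z in y₀..(y₀ + P (x ε) * (T - ε)), L z) / P (x ε)) := by
      filter_upwards [Ioo_mem_nhds h0.1 h0.2] with ε hε
      have hq : P (x ε) ≠ 0 := (hPpos _ (hxpos ε hε)).ne'
      rw [intervalIntegral.integral_comp_add_mul L hq]
      simp [div_eq_inv_mul]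
    refine HasDerivAt.congr_of_eventuallyEq (HasDerivAt.congr_deriv h3 ?_) hev
    have hξ : P x₀ / deriv P x₀ * (deriv P x₀ * T) = P x₀ * T := by field_simp
    unfold Sw
    rw [hξ, hparts, hx0]
    simp only [sub_zero]
    field_simp
    ring
  refine ⟨hmain, fun hS => ?_⟩
  have hpos : 0 < deriv P x₀ / P x₀ * Sw L (deriv P x₀ * T) (P x₀ / deriv P x₀) y₀ := by
    positivity
  have hs := (hasDerivAt_iff_tendsto_slope.1 hmain).eventually (lt_mem_nhds hpos)
  have hs' := hs.filter_mono (nhdsWithin_mono (0:ℝ) (fun z (hz : z ∈ Set.Ioi (0:ℝ)) =>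
    (ne_of_gt hz : z ≠ 0)))
  filter_upwards [hs', self_mem_nhdsWithin] with ε h1 h2
  have h2' : (0:ℝ) < ε := h2
  rw [slope_def_field] at h1
  have h4 := (div_pos_iff_of_pos_right (by linarith : 0 < ε - 0)).1 h1
  exact sub_pos.1 h4
end

section
/- Let P : (0,∞) → ℝ be twice differentiable with P(x) > 0, P'(x) > 0, and P''(x) ≤ 0 for all x > 0 (concave production), and let x : I → (0,∞) be differentiable on an interval I with x'(t) = P(x(t)). Then ξ(t) := P(x(t))/P'(x(t)) satisfies ξ'(t) = (P'(x(t)) − P''(x(t))·ξ(t))·ξ(t) ≥ P'(x(t))·ξ(t) for all t ∈ I. -/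
/-- For concave production (`P, P' > 0`, `P'' ≤ 0`) and a trajectory of
pure vegetative growth `ẋ = P(x)` on an interval `I`, the adjusted vegetative mass
`ξ = P(x)/P'(x)` satisfies `ξ' = (P'(x) − P''(x)ξ)·ξ ≥ P'(x)·ξ`. -/
theorem stmt_18 (P : ℝ → ℝ)
    (hPdiff : ∀ x : ℝ, 0 < x → DifferentiableAt ℝ P x)
    (hPdiff2 : ∀ x : ℝ, 0 < x → DifferentiableAt ℝ (deriv P) x)
    (hPpos : ∀ x : ℝ, 0 < x → 0 < P x)
    (hP'pos : ∀ x : ℝ, 0 < x → 0 < deriv P x)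
    (hP'' : ∀ x : ℝ, 0 < x → deriv (deriv P) x ≤ 0)
    (I : Set ℝ) (hI : I.OrdConnected)
    (x : ℝ → ℝ) (hxpos : ∀ t ∈ I, 0 < x t)
    (hx' : ∀ t ∈ I, HasDerivAt x (P (x t)) t) :
    ∀ t ∈ I,
      HasDerivAt (fun s : ℝ => P (x s) / deriv P (x s))
        ((deriv P (x t) - deriv (deriv P) (x t) * (P (x t) / deriv P (x t))) *
          (P (x t) / deriv P (x t))) t ∧
      deriv P (x t) * (P (x t) / deriv P (x t)) ≤
        (deriv P (x t) - deriv (deriv P) (x t) * (P (x t) / deriv P (x t))) *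
          (P (x t) / deriv P (x t)) := by
  intro t ht
  have hx := hxpos t ht
  have h1 := hP'pos _ hx
  have h0 := hPpos _ hx
  have h2 := hP'' _ hx
  constructor
  · have hA : HasDerivAt (fun s => P (x s)) (deriv P (x t) * P (x t)) t :=
      (hPdiff _ hx).hasDerivAt.comp t (hx' t ht)
    have hB : HasDerivAt (fun s => deriv P (x s)) (deriv (deriv P) (x t) * P (x t)) t :=
      (hPdiff2 _ hx).hasDerivAt.comp t (hx' t ht)
    have hC := hA.fun_div hB h1.ne'
    refine hC.congr_deriv ?_
    have h1n := h1.ne'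
    field_simp
  · have hq : 0 < P (x t) / deriv P (x t) := div_pos h0 h1
    apply mul_le_mul_of_nonneg_right _ hq.le
    nlinarith [mul_nonneg (neg_nonneg.mpr h2) hq.le]
end
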